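/- Let (X,d_X) be a compact connected geodesic space, r ∈ X, α > 0, and let G_α be the α-Reeb graph of d = d_X(r,·) associated to a finite open cover I of [0, diam(X)] by intervals of length at most α, assumed to be a finite metric graph. If there is a finite metric graph (G',d_{G'}) with d_GH(X,G') < ε, then d_GH(X,G_α) < (β_1(G_α)+1)·(4·(2+N_{E,G'}(4(α+2ε)))·(α+2ε) + ε). In particular, if every edge of G' has length greater than 4(α+2ε), then d_GH(X,G_α) < (β_1(G_α)+1)·(8α+17ε). -/

import Mathlib

open Set Metric

noncomputable section

/-- A finite metric graph structure on a metric space `G`: a finite set of edges, each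
isometrically parametrized by arc length on `[0, len e]`, covering `G`, with pairwise
disjoint open edges, and such that the metric of `G` is the associated shortest-path
metric (i.e. the largest pseudometric making all edge parametrizations 1-Lipschitz). -/
structure MetricGraphStruct (G : Type*) [MetricSpace G] where
  /-- the (finite) index type of edges -/
  E : Type
  fintypeE : Fintype E
  /-- length of each edge -/
  len : E → ℝ
  len_pos : ∀ e, 0 < len e
  /-- arc-length parametrization of each edge on `[0, len e]` -/
  param : E → ℝ → G
  param_lipschitz : ∀ e, LipschitzOnWith 1 (param e) (Set.Icc 0 (len e))
  /-- the edges cover `G` -/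
  cover : ∀ x : G, ∃ e, ∃ t ∈ Set.Icc 0 (len e), param e t = x
  /-- each open edge is simple -/
  injOn : ∀ e, Set.InjOn (param e) (Set.Ioo 0 (len e))
  /-- open edges are pairwise disjoint -/
  disjoint_interiors : ∀ e₁ e₂, e₁ ≠ e₂ → ∀ s ∈ Set.Ioo 0 (len e₁), ∀ t ∈ Set.Ioo 0 (len e₂),
    param e₁ s ≠ param e₂ t
  /-- endpoints of edges do not lie in open edges -/
  endpoint_not_interior : ∀ e e', ∀ t ∈ Set.Ioo 0 (len e'),
    param e 0 ≠ param e' t ∧ param e (len e) ≠ param e' t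
  /-- the metric of `G` is the shortest-path metric: it is maximal among pseudometrics
  making every edge parametrization 1-Lipschitz -/
  dist_maximal : ∀ δ : G → G → ℝ, (∀ p, δ p p = 0) → (∀ p q, δ p q = δ q p) →
    (∀ p q s, δ p s ≤ δ p q + δ q s) →
    (∀ e, ∀ s ∈ Set.Icc 0 (len e), ∀ t ∈ Set.Icc 0 (len e),
      δ (param e s) (param e t) ≤ |s - t|) →
    ∀ p q, δ p q ≤ dist p q

namespace MetricGraphStruct

variable {G : Type*} [MetricSpace G] (M : MetricGraphStruct G)

/-- first endpoint of an edge -/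
def src (e : M.E) : G := M.param e 0

/-- second endpoint of an edge -/
def tgt (e : M.E) : G := M.param e (M.len e)

/-- the set of vertices (endpoints of edges) -/
def vertexSet : Set G := {v | ∃ e, v = M.src e ∨ v = M.tgt e}

/-- `N_E(α)`: the number of edges of length at most `α` -/
def NE (α : ℝ) : ℕ := Nat.card {e : M.E // M.len e ≤ α}

/-- the first Betti number of a connected finite graph: `#E - #V + 1` -/
def betti1 : ℕ := Nat.card M.E + 1 - Nat.card M.vertexSet

end MetricGraphStruct

end

/-- A geodesic metric space: any two points are joined by an isometrically embedded
segment. -/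
def IsGeodesicSpace (X : Type*) [MetricSpace X] : Prop :=
  ∀ x y : X, ∃ γ : ℝ → X, γ 0 = x ∧ γ (dist x y) = y ∧
    ∀ s ∈ Set.Icc 0 (dist x y), ∀ t ∈ Set.Icc 0 (dist x y), dist (γ s) (γ t) = |s - t|

/-- The Reeb relation of the distance function `d = d_X(r, ·)`: two points are related if
they have the same distance to `r` and lie in the same path-connected component of the
corresponding level set of `d`. -/
def reebRel {X : Type*} [MetricSpace X] (r : X) (x y : X) : Prop :=
  dist r x = dist r y ∧ JoinedIn {z | dist r z = dist r x} x y

/-- `G` is the metric Reeb graph of the distance function `d = d_X(r, ·)` on `X`: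
`π : X → G` is the (continuous, surjective) quotient map of the Reeb relation, `d`
factors as `d_* ∘ π`, and `G` carries a finite metric graph structure whose edges are
parametrized so that `d_*` increases at unit speed along each edge (hence each edge has
length the variation of `d_*` along it), the metric on `G` being the associated
shortest-path metric. -/
structure ReebGraphOf (X : Type*) [MetricSpace X] (r : X)
    (G : Type*) [MetricSpace G] where
  /-- the finite metric graph structure on `G` -/
  graph : MetricGraphStruct G
  /-- the quotient map -/
  π : X → G
  continuous_π : Continuous π
  surj : Function.Surjective π
  /-- `π` identifies exactly the points equivalent under the Reeb relation -/
  eq_iff : ∀ x y : X, π x = π y ↔ reebRel r x y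
  /-- the function induced by `d` on the quotient -/
  dStar : G → ℝ
  dStar_π : ∀ x : X, dStar (π x) = dist r x
  /-- `d_*` increases at unit speed along each (oriented) edge -/
  dStar_param : ∀ e : graph.E, ∀ t ∈ Set.Icc 0 (graph.len e),
    dStar (graph.param e t) = dStar (graph.param e 0) + t

namespace ReebGraphOf

variable {X : Type*} [MetricSpace X] {r : X} {G : Type*} [MetricSpace G]

/-- A merging vertex: a point of `G` which is the terminal endpoint of at least two
distinct edges (edges being oriented by increasing `d_*`). -/
def IsMergingVertex (R : ReebGraphOf X r G) (v : G) : Prop :=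
  ∃ e₁ e₂ : R.graph.E, e₁ ≠ e₂ ∧ R.graph.tgt e₁ = v ∧ R.graph.tgt e₂ = v

/-- `M`: the supremum of the diameters of the fibers of `π`. -/
noncomputable def fiberDiamSup (R : ReebGraphOf X r G) : ℝ := ⨆ p : G, Metric.diam (R.π ⁻¹' {p})

end ReebGraphOf

/-- The `α`-Reeb relation associated to a covering `I` of the range of `d = d_X(r,·)` by
intervals: the equivalence generated by relating points with the same distance to `r`
that lie in the same path-connected component of `d⁻¹(I i)` for some `i`. -/
def alphaReebRel {X : Type*} [MetricSpace X] (r : X) {ι : Type*} (I : ι → Set ℝ)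
    (x y : X) : Prop :=
  Relation.EqvGen
    (fun a b => dist r a = dist r b ∧
      ∃ i : ι, JoinedIn {z | dist r z ∈ I i} a b) x y

/-- `G` is the metric `α`-Reeb graph of `d = d_X(r,·)` associated to the covering `I`:
the quotient of `X` by the `α`-Reeb relation, carrying a finite metric graph structure
whose edges are parametrized so that `d_*` increases at unit speed along them, with the
shortest-path metric. -/
structure AlphaReebGraphOf (X : Type*) [MetricSpace X] (r : X) {ι : Type*}
    (I : ι → Set ℝ) (G : Type*) [MetricSpace G] where
  /-- the finite metric graph structure on `G` -/
  graph : MetricGraphStruct G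
  /-- the quotient map -/
  π : X → G
  continuous_π : Continuous π
  surj : Function.Surjective π
  /-- `π` identifies exactly the points equivalent under the `α`-Reeb relation -/
  eq_iff : ∀ x y : X, π x = π y ↔ alphaReebRel r I x y
  /-- the function induced by `d` on the quotient -/
  dStar : G → ℝ
  dStar_π : ∀ x : X, dStar (π x) = dist r x
  /-- `d_*` increases at unit speed along each (oriented) edge -/
  dStar_param : ∀ e : graph.E, ∀ t ∈ Set.Icc 0 (graph.len e),
    dStar (graph.param e t) = dStar (graph.param e 0) + t

/-- `z` lies on a geodesic segment from the base point `r` to `x`. -/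
def IsDescent {X : Type*} [MetricSpace X] (r x z : X) : Prop :=
  dist r z + dist z x = dist r x

namespace IsGeodesicSpace

variable {X : Type*} [MetricSpace X]

/-- Geodesic segments extend to continuous maps on the line. -/
lemma exists_continuous (hX : IsGeodesicSpace X) (x y : X) :
    ∃ γ : ℝ → X, Continuous γ ∧ γ 0 = x ∧ γ (dist x y) = y ∧
      ∀ s ∈ Icc 0 (dist x y), ∀ t ∈ Icc 0 (dist x y), dist (γ s) (γ t) = |s - t| := by
  obtain ⟨γ, h0, h1, hγ⟩ := hX x y
  have hL : (0 : ℝ) ≤ dist x y := dist_nonneg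
  refine ⟨fun s => γ (projIcc 0 (dist x y) hL s), ?_, ?_, ?_, ?_⟩
  · have : Continuous (fun s : Icc (0 : ℝ) (dist x y) => γ s) := by
      have : Isometry (fun s : Icc (0 : ℝ) (dist x y) => γ s) :=
        Isometry.of_dist_eq fun s t => by
          rw [hγ s s.2 t t.2, Subtype.dist_eq, Real.dist_eq]
      exact this.continuous
    exact this.comp continuous_projIcc
  · simpa using h0
  · simpa using h1
  · intro s hs t ht
    simp only [projIcc_of_mem hL hs, projIcc_of_mem hL ht]
    exact hγ s hs t ht

/-- Two points are joined in any set containing all the points between them. -/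
lemma joinedIn (hX : IsGeodesicSpace X) {x y : X} {F : Set X}
    (hF : ∀ z, dist x z + dist z y = dist x y → z ∈ F) : JoinedIn F x y := by
  obtain ⟨γ, hc, h0, h1, hγ⟩ := hX.exists_continuous x y
  have hL : (0 : ℝ) ≤ dist x y := dist_nonneg
  refine JoinedIn.ofLine (f := fun s => γ (s * dist x y)) (by fun_prop) (by simpa) (by simpa) ?_
  rintro _ ⟨s, hs, rfl⟩
  apply hF
  have hs' : s * dist x y ∈ Icc 0 (dist x y) :=
    ⟨by have := hs.1; positivity, mul_le_of_le_one_left hL hs.2⟩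
  have e1 := hγ 0 ⟨le_rfl, hL⟩ _ hs'
  have e2 := hγ _ hs' _ ⟨hL, le_rfl⟩
  rw [h0] at e1
  rw [h1] at e2
  rw [e1, e2, abs_of_nonpos, abs_of_nonpos] <;> linarith [hs'.1, hs'.2]

lemma exists_descent (hX : IsGeodesicSpace X) (r x : X) {s : ℝ} (hs : s ∈ Icc 0 (dist r x)) :
    ∃ z, IsDescent r x z ∧ dist r z = s := by
  obtain ⟨γ, h0, h1, hγ⟩ := hX r x
  have hL : (0 : ℝ) ≤ dist r x := dist_nonneg
  have e1 := hγ 0 ⟨le_rfl, hL⟩ _ hs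
  have e2 := hγ _ hs _ ⟨hL, le_rfl⟩
  rw [h0, zero_sub, abs_neg, abs_of_nonneg hs.1] at e1
  rw [h1, abs_of_nonpos (by linarith [hs.2])] at e2
  exact ⟨γ s, by rw [IsDescent, e1, e2]; ring, e1⟩

end IsGeodesicSpace

namespace IsDescent

variable {X : Type*} [MetricSpace X] {r x y z : X}

lemma refl (r x : X) : IsDescent r x x := by simp [IsDescent]

lemma base (r x : X) : IsDescent r x r := by simp [IsDescent]

lemma dist_eq (h : IsDescent r x z) : dist x z = dist r x - dist r z := by
  rw [dist_comm]; unfold IsDescent at h; linarith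

lemma le (h : IsDescent r x z) : dist r z ≤ dist r x := by
  unfold IsDescent at h; linarith [dist_nonneg (x := z) (y := x)]

lemma trans (h : IsDescent r x y) (h' : IsDescent r y z) : IsDescent r x z := by
  unfold IsDescent at *
  have := dist_triangle z y x
  have := dist_triangle r z x
  linarith

/-- The points of a geodesic from `x` to a descent of `x` are descents of each other. -/
lemma of_between (h : IsDescent r x z) {w : X} (hw : dist x w + dist w z = dist x z) :
    IsDescent r x w ∧ IsDescent r w z := by
  unfold IsDescent at *
  have := dist_triangle r w x
  have := dist_triangle r z w
  have := dist_comm x w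
  have := dist_comm x z
  have := dist_comm z w
  constructor <;> linarith

/-- A continuous descending path from `x` to a descent of `x`. -/
lemma exists_path (hX : IsGeodesicSpace X) (h : IsDescent r x z) :
    ∃ γ : ℝ → X, Continuous γ ∧ γ 0 = x ∧ γ (dist r x - dist r z) = z ∧
      (∀ s ∈ Icc 0 (dist r x - dist r z), dist r (γ s) = dist r x - s) ∧
      ∀ s ∈ Icc 0 (dist r x - dist r z), ∀ t ∈ Icc 0 (dist r x - dist r z), s ≤ t →
        IsDescent r (γ s) (γ t) := by
  obtain ⟨γ, hc, h0, h1, hγ⟩ := hX.exists_continuous x z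
  rw [h.dist_eq] at h1 hγ
  have hL : 0 ≤ dist r x - dist r z := by linarith [h.le]
  have key : ∀ s ∈ Icc 0 (dist r x - dist r z), dist r (γ s) = dist r x - s := by
    intro s hs
    have e1 := hγ 0 ⟨le_rfl, hL⟩ _ hs
    have e2 := hγ _ hs _ ⟨hL, le_rfl⟩
    rw [h0, abs_of_nonpos (by linarith [hs.1])] at e1
    rw [h1, abs_of_nonpos (by linarith [hs.2])] at e2
    have := (h.of_between (w := γ s) (by rw [e1, e2, h.dist_eq]; ring)).1.dist_eq
    linarith
  refine ⟨γ, hc, h0, h1, key, fun s hs t ht hst => ?_⟩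
  unfold IsDescent
  rw [key s hs, key t ht, hγ t ht s hs, abs_of_nonneg (by linarith)]
  ring

end IsDescent

section AlphaReeb

variable {X : Type*} [MetricSpace X] {r : X} {ι : Type*} {I : ι → Set ℝ}

lemma alphaReebRel.dist_eq {x y : X} (h : alphaReebRel r I x y) : dist r x = dist r y := by
  induction h with
  | rel _ _ h => exact h.1
  | refl _ => rfl
  | symm _ _ _ ih => exact ih.symm
  | trans _ _ _ _ _ ih₁ ih₂ => exact ih₁.trans ih₂

lemma joinedIn_of_dist_lt (hX : IsGeodesicSpace X) {x z : X} {δ : ℝ} {i : ι}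
    (hδ : ball (dist r x) δ ⊆ I i) (hz : dist x z < δ) :
    JoinedIn {w | dist r w ∈ I i} x z := by
  refine hX.joinedIn fun w hw => hδ ?_
  rw [mem_ball, Real.dist_eq]
  have h1 := dist_triangle r x w
  have h2 := dist_triangle r w x
  rw [dist_comm w x] at h2
  have := dist_nonneg (x := w) (y := z)
  rw [abs_lt]
  constructor <;> linarith

/-- Short descents of related points are related. -/
lemma alphaReebRel.local_descent (hX : IsGeodesicSpace X) (hI : ∀ i, IsOpen (I i))
    (hc : ∀ x : X, ∃ i, dist r x ∈ I i) {x x' : X} (h : alphaReebRel r I x x') :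
    ∃ η > 0, ∀ z z', IsDescent r x z → IsDescent r x' z' → dist r z = dist r z' →
      dist r x - dist r z < η → alphaReebRel r I z z' := by
  have gen : ∀ a b, dist r a = dist r b → ∀ i, JoinedIn {z | dist r z ∈ I i} a b →
      ∃ η > 0, ∀ z z', IsDescent r a z → IsDescent r b z' → dist r z = dist r z' →
      dist r a - dist r z < η → alphaReebRel r I z z' := by
    intro a b hab i hj
    obtain ⟨η, hη, hball⟩ := Metric.isOpen_iff.1 (hI i) _ hj.source_mem
    refine ⟨η, hη, fun z z' hz hz' e hlt => ?_⟩
    have j1 := joinedIn_of_dist_lt hX hball (z := z) (by rw [hz.dist_eq]; exact hlt)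
    have j2 := joinedIn_of_dist_lt (x := b) hX (hab ▸ hball) (z := z')
      (by rw [hz'.dist_eq, ← hab, ← e]; exact hlt)
    exact .rel _ _ ⟨e, i, j1.symm.trans (hj.trans j2)⟩
  induction h with
  | rel a b h => exact gen a b h.1 _ h.2.choose_spec
  | refl a =>
    obtain ⟨i, hi⟩ := hc a
    exact gen a a rfl i (JoinedIn.refl hi)
  | symm a b h ih =>
    obtain ⟨η, hη, ih⟩ := ih
    have := alphaReebRel.dist_eq h
    exact ⟨η, hη, fun z z' hz hz' e hlt => .symm _ _ (ih z' z hz' hz e.symm (by linarith))⟩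
  | trans a b c h1 h2 ih1 ih2 =>
    obtain ⟨η1, hη1, ih1⟩ := ih1
    obtain ⟨η2, hη2, ih2⟩ := ih2
    refine ⟨min η1 η2, lt_min hη1 hη2, fun z z' hz hz' e hlt => ?_⟩
    have e1 := alphaReebRel.dist_eq h1
    obtain ⟨w, hw, hwe⟩ := hX.exists_descent r b (s := dist r z) ⟨dist_nonneg, by
      rw [← e1]; exact hz.le⟩
    refine .trans _ w _ (ih1 z w hz hw hwe.symm (hlt.trans_le (min_le_left _ _)))
      (ih2 w z' hw hz' (hwe.trans e) ?_)
    rw [hwe, ← e1]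
    exact hlt.trans_le (min_le_right _ _)

namespace AlphaReebGraphOf

variable {G : Type*} [MetricSpace G]

lemma dist_eq_of_map_eq (R : AlphaReebGraphOf X r I G) {x x' : X} (h : R.π x = R.π x') :
    dist r x = dist r x' := by
  rw [← R.dStar_π, ← R.dStar_π, h]

/-- Descents of points in the same fiber lie in the same fiber. -/
lemma map_descent_eq (R : AlphaReebGraphOf X r I G) (hX : IsGeodesicSpace X)
    (hI : ∀ i, IsOpen (I i)) (hc : ∀ x : X, ∃ i, dist r x ∈ I i) {x x' z z' : X}
    (h : R.π x = R.π x') (hz : IsDescent r x z) (hz' : IsDescent r x' z')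
    (e : dist r z = dist r z') : R.π z = R.π z' := by
  have ht := R.dist_eq_of_map_eq h
  obtain ⟨γ, γc, γ0, γ1, γd, γD⟩ := hz.exists_path hX
  obtain ⟨γ', γc', γ0', γ1', γd', γD'⟩ := hz'.exists_path hX
  rw [← ht, ← e] at γ1' γd' γD'
  set L := dist r x - dist r z with hL
  have hL0 : 0 ≤ L := by linarith [hz.le]
  have hcl : IsClosed ({s | R.π (γ s) = R.π (γ' s)} ∩ Icc 0 L) :=
    (isClosed_eq (R.continuous_π.comp γc) (R.continuous_π.comp γc')).inter isClosed_Icc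
  have key := IsClosed.Icc_subset_of_forall_mem_nhdsWithin hcl (by simp [γ0, γ0', h]) ?_
  · have := key ⟨hL0, le_rfl⟩
    simpa [γ1, γ1'] using this
  rintro s ⟨hs, hsL⟩
  obtain ⟨η, hη, hloc⟩ := alphaReebRel.local_descent hX hI hc ((R.eq_iff _ _).1 hs)
  have : Ioo s (min (s + η) L) ∈ nhdsWithin s (Ioi s) :=
    Ioo_mem_nhdsGT (lt_min (by linarith) hsL.2)
  filter_upwards [this] with u hu
  have h1 : u < s + η := hu.2.trans_le (min_le_left _ _)
  have h2 : u < L := hu.2.trans_le (min_le_right _ _)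
  have hu' : u ∈ Icc 0 L := ⟨by linarith [hsL.1, hu.1], h2.le⟩
  have hs' : s ∈ Icc 0 L := ⟨hsL.1, hsL.2.le⟩
  refine (R.eq_iff _ _).2 (hloc _ _ (γD s hs' u hu' hu.1.le) (γD' s hs' u hu' hu.1.le) ?_ ?_)
  · rw [γd u hu', γd' u hu']
  · rw [γd u hu', γd s hs']; linarith

/-- Near `π x`, the points below `x` are the images of the descents of `x`. -/
lemma eventually_eq_descent [CompactSpace X] (R : AlphaReebGraphOf X r I G)
    (hX : IsGeodesicSpace X) (hI : ∀ i, IsOpen (I i)) (hc : ∀ x : X, ∃ i, dist r x ∈ I i)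
    (x : X) : ∀ᶠ q in nhds (R.π x), ∀ w, R.π w = q → dist r w ≤ dist r x →
      ∀ z, IsDescent r x z → dist r z = dist r w → q = R.π z := by
  have H : ∀ v ∈ R.π ⁻¹' {R.π x}, ∀ᶠ w in nhds v, dist r w ≤ dist r x →
      ∀ z, IsDescent r x z → dist r z = dist r w → R.π w = R.π z := by
    intro v hv
    have hv : R.π v = R.π x := hv
    have hvx := R.dist_eq_of_map_eq hv
    obtain ⟨i, hi⟩ := hc v
    obtain ⟨η, hη, hball⟩ := Metric.isOpen_iff.1 (hI i) _ hi
    filter_upwards [Metric.ball_mem_nhds v hη] with w hw hwx z hz hzw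
    rw [mem_ball, dist_comm] at hw
    obtain ⟨z', hz', hzz'⟩ := hX.exists_descent r v (s := dist r w) ⟨dist_nonneg, by
      rw [hvx]; exact hwx⟩
    have hw1 : R.π w = R.π z' := by
      rw [R.eq_iff]
      refine .rel _ _ ⟨hzz'.symm, i, (joinedIn_of_dist_lt hX hball hw).symm.trans
        (joinedIn_of_dist_lt hX hball ?_)⟩
      rw [hz'.dist_eq, hzz']
      have := dist_triangle r w v
      rw [dist_comm w v] at this
      linarith
    rw [hw1]
    exact R.map_descent_eq hX hI hc hv hz' hz (hzz'.trans hzw.symm)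
  have := (R.continuous_π.isClosedMap).eventually_nhds_fiber (R.π x) H
  filter_upwards [this] with q hq w hw h1 z hz h2
  rw [← hw]
  exact hq w hw h1 z hz h2

end AlphaReebGraphOf

end AlphaReeb

namespace MetricGraphStruct

variable {G : Type*} [MetricSpace G] (M : MetricGraphStruct G)

lemma continuousOn_param (e : M.E) : ContinuousOn (M.param e) (Icc 0 (M.len e)) :=
  (M.param_lipschitz e).continuousOn

lemma dist_param_le (e : M.E) {s t : ℝ} (hs : s ∈ Icc 0 (M.len e)) (ht : t ∈ Icc 0 (M.len e)) :
    dist (M.param e s) (M.param e t) ≤ |s - t| := by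
  have := (M.param_lipschitz e).dist_le_mul s hs t ht
  simpa [Real.dist_eq] using this

/-- The closed edge. -/
def edge (e : M.E) : Set G := M.param e '' Icc 0 (M.len e)

lemma isCompact_edge (e : M.E) : IsCompact (M.edge e) :=
  isCompact_Icc.image_of_continuousOn (M.continuousOn_param e)

lemma isClosed_edge (e : M.E) : IsClosed (M.edge e) := (M.isCompact_edge e).isClosed

lemma exists_mem_edge (y : G) : ∃ e, y ∈ M.edge e := by
  obtain ⟨e, t, ht, h⟩ := M.cover y
  exact ⟨e, t, ht, h⟩

end MetricGraphStruct

namespace AlphaReebGraphOf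

variable {X : Type*} [MetricSpace X] {r : X} {ι : Type*} {I : ι → Set ℝ}
variable {G : Type*} [MetricSpace G]

/-- Edges of the `α`-Reeb graph are the images of descending geodesics. -/
lemma param_sub_eq [CompactSpace X] (R : AlphaReebGraphOf X r I G)
    (hX : IsGeodesicSpace X) (hI : ∀ i, IsOpen (I i)) (hc : ∀ x : X, ∃ i, dist r x ∈ I i)
    (e : R.graph.E) {s t : ℝ} (hs : s ∈ Icc 0 (R.graph.len e)) (ht : t ∈ Icc 0 (R.graph.len e))
    (hst : s ≤ t) {x z : X} (hx : R.π x = R.graph.param e t) (hz : IsDescent r x z)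
    (hzx : dist r z = dist r x - (t - s)) : R.graph.param e s = R.π z := by
  obtain ⟨γ, γc, γ0, γ1, γd, γD⟩ := hz.exists_path hX
  have hLe : dist r x - dist r z = t - s := by linarith
  rw [hLe] at γ1 γd γD
  set L := t - s with hL
  have hL0 : 0 ≤ L := by linarith
  have hpc : ContinuousOn (fun u => R.graph.param e (t - u)) (Icc 0 L) := by
    refine (R.graph.continuousOn_param e).comp (by fun_prop) ?_
    intro u hu
    exact ⟨by linarith [hu.2, hs.1], by linarith [hu.1, ht.2]⟩
  have hcl : IsClosed ({u | R.graph.param e (t - u) = R.π (γ u)} ∩ Icc 0 L) := by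
    have : ContinuousOn (fun u => (R.graph.param e (t - u), R.π (γ u))) (Icc 0 L) :=
      hpc.prodMk (R.continuous_π.comp γc).continuousOn
    have := this.preimage_isClosed_of_isClosed isClosed_Icc (isClosed_diagonal (X := G))
    rw [inter_comm] at this
    convert this using 2
    ext u
    simp [diagonal]
  have key := IsClosed.Icc_subset_of_forall_mem_nhdsWithin hcl (by simp [γ0, hx]) ?_
  · have := key ⟨hL0, le_rfl⟩
    simp only [mem_ofPred_eq, γ1] at this
    rw [← this, hL]
    simp
  rintro u ⟨hu, huL⟩
  have hu : R.graph.param e (t - u) = R.π (γ u) := hu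
  have hev := R.eventually_eq_descent hX hI hc (γ u)
  rw [← hu] at hev
  have hcw : ContinuousWithinAt (fun u => R.graph.param e (t - u)) (Icc 0 L) u :=
    hpc u ⟨huL.1, huL.2.le⟩
  have h1 := hcw.eventually hev
  have h2 : Ioo u L ∈ nhdsWithin u (Ioi u) := Ioo_mem_nhdsGT huL.2
  have h3 : nhdsWithin u (Ioi u) ≤ nhdsWithin u (Icc 0 L) := by
    refine nhdsWithin_le_of_mem ?_
    filter_upwards [h2] with v hv using ⟨by linarith [huL.1, hv.1], hv.2.le⟩
  filter_upwards [h3 h1, h2] with v hv hvL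
  obtain ⟨w, hw⟩ := R.surj (R.graph.param e (t - v))
  have huI : u ∈ Icc 0 L := ⟨huL.1, huL.2.le⟩
  have hvI : v ∈ Icc 0 L := ⟨by linarith [huL.1, hvL.1], hvL.2.le⟩
  have hdw : dist r w = dist r (γ v) := by
    have e1 := R.dStar_param e (t - v) ⟨by linarith [hvI.2, hs.1], by linarith [hvI.1, ht.2]⟩
    have e2 := R.dStar_param e t ht
    rw [← hx, R.dStar_π] at e2
    rw [← hw, R.dStar_π] at e1
    rw [γd v hvI]
    linarith
  refine hv w hw ?_ (γ v) (γD u huI v hvI hvL.1.le) hdw.symm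
  rw [hdw, γd v hvI, γd u huI]
  linarith [hvL.1]

lemma eventually_dist_le (R : AlphaReebGraphOf X r I G) (p : G) :
    ∀ᶠ q in nhds p, dist p q ≤ |R.dStar p - R.dStar q| := by
  have := R.graph.fintypeE
  have hcl : IsClosed (⋃ e ∈ {e : R.graph.E | p ∉ R.graph.edge e}, R.graph.edge e) :=
    (Set.toFinite _).isClosed_biUnion fun e _ => R.graph.isClosed_edge e
  have : (⋃ e ∈ {e : R.graph.E | p ∉ R.graph.edge e}, R.graph.edge e)ᶜ ∈ nhds p := by
    refine hcl.isOpen_compl.mem_nhds ?_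
    simp
  filter_upwards [this] with q hq
  obtain ⟨e, he⟩ := R.graph.exists_mem_edge q
  have hp : p ∈ R.graph.edge e := by
    by_contra hp
    exact hq (mem_biUnion (show e ∈ {e | p ∉ R.graph.edge e} from hp) he)
  obtain ⟨s, hs, rfl⟩ := hp
  obtain ⟨t, ht, rfl⟩ := he
  refine (R.graph.dist_param_le e hs ht).trans (le_of_eq ?_)
  rw [R.dStar_param e s hs, R.dStar_param e t ht]
  congr 1; ring

lemma dist_map_le (R : AlphaReebGraphOf X r I G) (hX : IsGeodesicSpace X) (x y : X) :
    dist (R.π x) (R.π y) ≤ dist x y := by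
  obtain ⟨γ, γc, γ0, γ1, γd⟩ := hX.exists_continuous x y
  have hL0 : 0 ≤ dist x y := dist_nonneg
  have hcl : IsClosed ({s | dist (R.π x) (R.π (γ s)) ≤ s} ∩ Icc 0 (dist x y)) :=
    (isClosed_le (continuous_const.dist (R.continuous_π.comp γc)) continuous_id).inter
      isClosed_Icc
  have key := IsClosed.Icc_subset_of_forall_mem_nhdsWithin hcl (by simp [γ0]) ?_
  · have := key ⟨hL0, le_rfl⟩
    simpa [γ1] using this
  rintro u ⟨hu, huL⟩
  have hu : dist (R.π x) (R.π (γ u)) ≤ u := hu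
  have h1 := (R.continuous_π.comp γc).continuousAt.eventually
    (R.eventually_dist_le (R.π (γ u)))
  have h2 : Ioo u (dist x y) ∈ nhdsWithin u (Ioi u) := Ioo_mem_nhdsGT huL.2
  filter_upwards [mem_nhdsWithin_of_mem_nhds h1, h2] with v hv hvL
  have hv : dist (R.π (γ u)) (R.π (γ v)) ≤ |R.dStar (R.π (γ u)) - R.dStar (R.π (γ v))| := hv
  rw [R.dStar_π, R.dStar_π] at hv
  have h3 := γd u ⟨huL.1, huL.2.le⟩ v ⟨huL.1.trans hvL.1.le, hvL.2.le⟩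
  rw [abs_of_nonpos (by linarith [hvL.1])] at h3
  have h4 := abs_dist_sub_le (γ u) (γ v) r
  rw [dist_comm _ r, dist_comm _ r] at h4
  have := dist_triangle (R.π x) (R.π (γ u)) (R.π (γ v))
  show dist (R.π x) (R.π (γ v)) ≤ v
  linarith

lemma dist_le_dist_map_add [CompactSpace X] (R : AlphaReebGraphOf X r I G)
    (hX : IsGeodesicSpace X) (hI : ∀ i, IsOpen (I i)) (hc : ∀ x : X, ∃ i, dist r x ∈ I i)
    {m : ℝ} (hm : ∀ x x', R.π x = R.π x' → dist x x' ≤ m) (x y : X) :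
    dist x y ≤ dist (R.π x) (R.π y) + m := by
  let A : X → X → Set ℝ := fun x y =>
    {s | ∃ z z', IsDescent r x z ∧ IsDescent r y z' ∧ dist r z = s ∧ dist r z' = s ∧
      R.π z = R.π z'}
  have A0 : ∀ x y, (0 : ℝ) ∈ A x y := fun x y =>
    ⟨r, r, .base r x, .base r y, dist_self r, dist_self r, rfl⟩
  have Asymm : ∀ x y, A x y ⊆ A y x := by
    rintro x y s ⟨z, z', h1, h2, h3, h4, h5⟩
    exact ⟨z', z, h2, h1, h4, h3, h5.symm⟩
  have Ale : ∀ x y, ∀ s ∈ A x y, s ≤ dist r x := by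
    rintro x y s ⟨z, z', h1, h2, rfl, h4, h5⟩
    exact h1.le
  have Abdd : ∀ x y, BddAbove (A x y) := fun x y => ⟨_, Ale x y⟩
  have Adown : ∀ x y, ∀ s ∈ A x y, ∀ u, 0 ≤ u → u ≤ s → u ∈ A x y := by
    rintro x y s ⟨z, z', h1, h2, rfl, h4, h5⟩ u hu0 hus
    obtain ⟨w, hw, hwu⟩ := hX.exists_descent r z ⟨hu0, hus⟩
    obtain ⟨w', hw', hwu'⟩ := hX.exists_descent r z' (s := u) ⟨hu0, by rwa [h4]⟩
    exact ⟨w, w', h1.trans hw, h2.trans hw', hwu, hwu',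
      R.map_descent_eq hX hI hc h5 hw hw' (hwu.trans hwu'.symm)⟩
  have Atrans : ∀ x y w, ∀ s ∈ A x y, s ∈ A y w → s ∈ A x w := by
    rintro x y w s ⟨z, z', h1, h2, h3, h4, h5⟩ ⟨u, u', k1, k2, k3, k4, k5⟩
    exact ⟨z, u', h1, k2, h3, k4, h5.trans
      ((R.map_descent_eq hX hI hc rfl h2 k1 (h4.trans k3.symm)).trans k5)⟩
  have Snn : ∀ x y, 0 ≤ sSup (A x y) := fun x y => le_csSup (Abdd x y) (A0 x y)
  choose σ hσ using R.surj
  let δ : G → G → ℝ := fun p q =>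
    dist r (σ p) + dist r (σ q) - 2 * sSup (A (σ p) (σ q))
  have key : ∀ p q, δ p q ≤ dist p q := by
    refine R.graph.dist_maximal δ ?_ ?_ ?_ ?_
    · intro p
      have h1 : sSup (A (σ p) (σ p)) = dist r (σ p) := by
        refine le_antisymm (csSup_le ⟨0, A0 _ _⟩ (Ale _ _)) (le_csSup (Abdd _ _) ?_)
        exact ⟨_, _, .refl _ _, .refl _ _, rfl, rfl, rfl⟩
      simp only [δ, h1]; ring
    · intro p q
      have : A (σ p) (σ q) = A (σ q) (σ p) := (Asymm _ _).antisymm (Asymm _ _)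
      simp only [δ, this]; ring
    · intro p q s
      simp only [δ]
      have h1 : sSup (A (σ p) (σ q)) ≤ dist r (σ q) :=
        csSup_le ⟨0, A0 _ _⟩ fun u hu => Ale _ _ u (Asymm _ _ hu)
      have h2 : sSup (A (σ q) (σ s)) ≤ dist r (σ q) := csSup_le ⟨0, A0 _ _⟩ (Ale _ _)
      have h3 : min (sSup (A (σ p) (σ q))) (sSup (A (σ q) (σ s))) ≤ sSup (A (σ p) (σ s)) := by
        refine le_of_forall_lt fun c hc => ?_
        obtain ⟨hc1, hc2⟩ := lt_min_iff.1 hc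
        obtain ⟨a, ha, hca⟩ := exists_lt_of_lt_csSup ⟨0, A0 _ _⟩ hc1
        obtain ⟨b, hb, hcb⟩ := exists_lt_of_lt_csSup ⟨0, A0 _ _⟩ hc2
        have hab : max 0 (min a b) = min a b ∨ max 0 (min a b) = 0 := by
          rcases le_total 0 (min a b) with h | h
          · left; exact max_eq_right h
          · right; exact max_eq_left h
        have mem : max 0 (min a b) ∈ A (σ p) (σ s) := by
          rcases hab with h | h
          · have h0 : 0 ≤ min a b := by rw [← h]; exact le_max_left _ _
            rw [h]
            exact Atrans _ _ _ _ (Adown _ _ a ha _ h0 (min_le_left _ _))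
              (Adown _ _ b hb _ h0 (min_le_right _ _))
          · rw [h]; exact A0 _ _
        exact ((lt_min hca hcb).trans_le (le_max_right _ _)).trans_le (le_csSup (Abdd _ _) mem)
      rcases min_choice (sSup (A (σ p) (σ q))) (sSup (A (σ q) (σ s))) with h | h <;>
        rw [h] at h3 <;> linarith
    · intro e
      have wlog_le : ∀ s ∈ Icc 0 (R.graph.len e), ∀ t ∈ Icc 0 (R.graph.len e), s ≤ t →
          dist r (σ (R.graph.param e s)) ∈ A (σ (R.graph.param e s)) (σ (R.graph.param e t)) ∧
          dist r (σ (R.graph.param e t)) - dist r (σ (R.graph.param e s)) = t - s := by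
        intro s hs t ht hst
        have e1 := R.dStar_param e s hs
        have e2 := R.dStar_param e t ht
        rw [← hσ (R.graph.param e s), R.dStar_π] at e1
        rw [← hσ (R.graph.param e t), R.dStar_π] at e2
        obtain ⟨z, hz, hzs⟩ := hX.exists_descent r (σ (R.graph.param e t))
          (s := dist r (σ (R.graph.param e s))) ⟨dist_nonneg, by linarith⟩
        have := R.param_sub_eq hX hI hc e hs ht hst (hσ _) hz (by linarith)
        exact ⟨⟨_, z, .refl _ _, hz, rfl, hzs, (hσ _).trans this⟩, by linarith⟩
      intro s hs t ht
      simp only [δ]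
      rcases le_total s t with h | h
      · obtain ⟨h1, h2⟩ := wlog_le s hs t ht h
        have := le_csSup (Abdd _ _) h1
        rw [abs_of_nonpos (by linarith)]
        linarith
      · obtain ⟨h1, h2⟩ := wlog_le t ht s hs h
        have := le_csSup (Abdd _ _) (Asymm _ _ h1)
        rw [abs_of_nonneg (by linarith)]
        linarith
  have hx := R.dist_eq_of_map_eq (hσ (R.π x))
  have hy := R.dist_eq_of_map_eq (hσ (R.π y))
  have hk := key (R.π x) (R.π y)
  simp only [δ] at hk
  have hsup : sSup (A (σ (R.π x)) (σ (R.π y))) ≤ (dist r x + dist r y + m - dist x y) / 2 := by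
    refine csSup_le ⟨0, A0 _ _⟩ ?_
    rintro s ⟨z, z', h1, h2, h3, h4, h5⟩
    obtain ⟨w, hw, hws⟩ := hX.exists_descent r x (s := s) ⟨by rw [← h3]; exact dist_nonneg, by
      rw [← hx, ← h3]; exact h1.le⟩
    obtain ⟨w', hw', hws'⟩ := hX.exists_descent r y (s := s)
      ⟨by rw [← h3]; exact dist_nonneg, by rw [← hy, ← h4]; exact h2.le⟩
    have e1 := R.map_descent_eq hX hI hc (hσ (R.π x)) h1 hw (h3.trans hws.symm)
    have e2 := R.map_descent_eq hX hI hc (hσ (R.π y)) h2 hw' (h4.trans hws'.symm)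
    have := hm w w' (e1.symm.trans (h5.trans e2))
    have t1 := dist_triangle x w y
    have t2 := dist_triangle w w' y
    have t3 := hw.dist_eq
    have t4 := hw'.dist_eq
    rw [dist_comm] at t4
    linarith
  linarith

/-- The Gromov-Hausdorff distance to the `α`-Reeb graph is at most half the maximal diameter
of the fibers. -/
lemma ghDist_le [CompactSpace X] [Nonempty X] [CompactSpace G] [Nonempty G]
    (R : AlphaReebGraphOf X r I G)
    (hX : IsGeodesicSpace X) (hI : ∀ i, IsOpen (I i)) (hc : ∀ x : X, ∃ i, dist r x ∈ I i)
    {m : ℝ} (hm : ∀ x x', R.π x = R.π x' → dist x x' ≤ m) :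
    GromovHausdorff.ghDist X G ≤ m / 2 := by
  have := GromovHausdorff.ghDist_le_of_approx_subsets (X := X) (Y := G) (s := univ)
    (fun x => R.π x) (ε₁ := 0) (ε₂ := m) (ε₃ := 0) (fun x => ⟨x, mem_univ _, by simp⟩)
    (fun p => by
      obtain ⟨x, rfl⟩ := R.surj p
      exact ⟨⟨x, mem_univ _⟩, by simp⟩)
    (fun x y => by
      have h1 := R.dist_map_le hX x y
      have h2 := R.dist_le_dist_map_add hX hI hc hm x y
      rw [Subtype.dist_eq, abs_le]
      constructor <;> linarith)
  linarith

end AlphaReebGraphOf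

namespace MetricGraphStruct

variable {G : Type*} [MetricSpace G] (M : MetricGraphStruct G)

/-- The open edge. -/
def openEdge (e : M.E) : Set G := M.param e '' Ioo 0 (M.len e)

lemma zero_mem (e : M.E) : (0 : ℝ) ∈ Icc 0 (M.len e) := ⟨le_rfl, (M.len_pos e).le⟩

lemma len_mem (e : M.E) : M.len e ∈ Icc 0 (M.len e) := ⟨(M.len_pos e).le, le_rfl⟩

lemma src_mem_vertexSet (e : M.E) : M.src e ∈ M.vertexSet := ⟨e, .inl rfl⟩

lemma tgt_mem_vertexSet (e : M.E) : M.tgt e ∈ M.vertexSet := ⟨e, .inr rfl⟩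

lemma finite_vertexSet : M.vertexSet.Finite := by
  have := M.fintypeE
  refine ((Set.finite_range M.src).union (Set.finite_range M.tgt)).subset ?_
  rintro v ⟨e, h | h⟩
  exacts [.inl ⟨e, h.symm⟩, .inr ⟨e, h.symm⟩]

lemma notMem_openEdge_of_mem_vertexSet {v : G} (hv : v ∈ M.vertexSet) (e : M.E) :
    v ∉ M.openEdge e := by
  rintro ⟨s, hs, rfl⟩
  obtain ⟨e', h | h⟩ := hv
  exacts [(M.endpoint_not_interior e' e s hs).1 h.symm,
    (M.endpoint_not_interior e' e s hs).2 h.symm]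

lemma openEdge_subset_edge (e : M.E) : M.openEdge e ⊆ M.edge e :=
  image_mono Ioo_subset_Icc_self

lemma eq_or_mem_Ioo {e : M.E} {s : ℝ} (hs : s ∈ Icc 0 (M.len e)) :
    s = 0 ∨ s = M.len e ∨ s ∈ Ioo 0 (M.len e) := by
  rcases hs.1.eq_or_lt with h | h
  · exact .inl h.symm
  rcases hs.2.eq_or_lt with h' | h'
  · exact .inr (.inl h')
  · exact .inr (.inr ⟨h, h'⟩)

lemma mem_edge_cases {e : M.E} {y : G} (hy : y ∈ M.edge e) :
    y = M.src e ∨ y = M.tgt e ∨ y ∈ M.openEdge e := by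
  obtain ⟨s, hs, rfl⟩ := hy
  rcases M.eq_or_mem_Ioo hs with rfl | rfl | h
  exacts [.inl rfl, .inr (.inl rfl), .inr (.inr ⟨s, h, rfl⟩)]

lemma param_eq_param {e e' : M.E} {s s' : ℝ} (hs : s ∈ Icc 0 (M.len e))
    (hs' : s' ∈ Icc 0 (M.len e')) (h : M.param e s = M.param e' s') :
    (e = e' ∧ s = s') ∨ ((s = 0 ∨ s = M.len e) ∧ (s' = 0 ∨ s' = M.len e')) := by
  rcases M.eq_or_mem_Ioo hs with h1 | h1 | h1 <;> rcases M.eq_or_mem_Ioo hs' with h2 | h2 | h2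
  · exact .inr ⟨.inl h1, .inl h2⟩
  · exact .inr ⟨.inl h1, .inr h2⟩
  · subst h1; exact absurd h (M.endpoint_not_interior e e' s' h2).1
  · exact .inr ⟨.inr h1, .inl h2⟩
  · exact .inr ⟨.inr h1, .inr h2⟩
  · subst h1; exact absurd h (M.endpoint_not_interior e e' s' h2).2
  · subst h2; exact absurd h.symm (M.endpoint_not_interior e' e s h1).1
  · subst h2; exact absurd h.symm (M.endpoint_not_interior e' e s h1).2
  · by_cases he : e = e'
    · subst he
      exact .inl ⟨rfl, M.injOn e h1 h2 h⟩
    · exact absurd h (M.disjoint_interiors e e' he s h1 s' h2)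

lemma eq_of_mem_openEdge {e e' : M.E} {y : G} (h : y ∈ M.openEdge e) (h' : y ∈ M.edge e') :
    e = e' := by
  obtain ⟨s, hs, rfl⟩ := h
  obtain ⟨s', hs', h⟩ := h'
  rcases M.param_eq_param (Ioo_subset_Icc_self hs) hs' h.symm with h | ⟨h | h, -⟩
  · exact h.1
  · exact absurd h hs.1.ne'
  · exact absurd h hs.2.ne

lemma isOpen_openEdge (e : M.E) : IsOpen (M.openEdge e) := by
  have := M.fintypeE
  have : M.openEdge e =
      ((⋃ e' ∈ {e' : M.E | e' ≠ e}, M.edge e') ∪ {M.src e, M.tgt e})ᶜ := by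
    ext y
    constructor
    · rintro hy (h | h)
      · obtain ⟨e', he', h⟩ := mem_iUnion₂.1 h
        exact he' (M.eq_of_mem_openEdge hy h).symm
      · rcases h with rfl | rfl
        · exact M.notMem_openEdge_of_mem_vertexSet (M.src_mem_vertexSet e) e hy
        · exact M.notMem_openEdge_of_mem_vertexSet (M.tgt_mem_vertexSet e) e hy
    · intro hy
      obtain ⟨e', he'⟩ := M.exists_mem_edge y
      by_cases h : e' = e
      · subst h
        rcases M.mem_edge_cases he' with h | h | h
        · exact absurd (.inr (.inl h)) hy
        · exact absurd (.inr (.inr h)) hy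
        · exact h
      · exact absurd (.inl (mem_biUnion (show e' ∈ {e' | e' ≠ e} from h) he')) hy
  rw [this]
  exact (((Set.toFinite _).isClosed_biUnion fun e _ => M.isClosed_edge e).union
    (Set.toFinite _).isClosed).isOpen_compl

lemma edge_union_compl_openEdge (e : M.E) : M.edge e ∪ (M.openEdge e)ᶜ = univ := by
  refine eq_univ_of_forall fun y => ?_
  by_cases h : y ∈ M.openEdge e
  exacts [.inl (M.openEdge_subset_edge e h), .inr h]

/-- Functions on a metric graph whose restrictions to the edges are `1`-Lipschitz are
`1`-Lipschitz. -/
lemma abs_sub_le_dist (φ : G → ℝ) (hφ : ∀ e, ∀ s ∈ Icc 0 (M.len e), ∀ t ∈ Icc 0 (M.len e),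
    |φ (M.param e s) - φ (M.param e t)| ≤ |s - t|) (p q : G) : |φ p - φ q| ≤ dist p q :=
  M.dist_maximal (fun p q => |φ p - φ q|) (by simp) (fun p q => abs_sub_comm _ _)
    (fun p q s => abs_sub_le _ _ _) hφ p q

/-- Compatible `1`-Lipschitz functions on the edges glue to a `1`-Lipschitz function. -/
lemma exists_glue (h : G → ℝ) (g : M.E → ℝ → ℝ) (h0 : ∀ e, g e 0 = h (M.src e))
    (h1 : ∀ e, g e (M.len e) = h (M.tgt e))
    (hg : ∀ e, ∀ s ∈ Icc 0 (M.len e), ∀ t ∈ Icc 0 (M.len e), |g e s - g e t| ≤ |s - t|) :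
    ∃ φ : G → ℝ, (∀ e, ∀ s ∈ Icc 0 (M.len e), φ (M.param e s) = g e s) ∧
      (∀ v ∈ M.vertexSet, φ v = h v) ∧ ∀ p q, |φ p - φ q| ≤ dist p q := by
  choose e t ht hy using M.cover
  have key : ∀ e', ∀ s ∈ Icc 0 (M.len e'), g (e (M.param e' s)) (t (M.param e' s)) = g e' s := by
    intro e' s hs
    have end_eq : ∀ e s, (s = 0 ∨ s = M.len e) → g e s = h (M.param e s) := by
      rintro e s (rfl | rfl)
      exacts [h0 e, h1 e]
    have hy' := hy (M.param e' s)
    rcases M.param_eq_param (ht _) hs hy' with ⟨h1, h2⟩ | ⟨h1, h2⟩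
    · rw [h1, h2]
    · rw [end_eq _ _ h1, end_eq _ _ h2, hy']
  refine ⟨fun y => g (e y) (t y), key, ?_, M.abs_sub_le_dist _ ?_⟩
  · rintro v ⟨e', rfl | rfl⟩
    · rw [← h0]; exact key e' 0 (M.zero_mem e')
    · rw [← h1]; exact key e' _ (M.len_mem e')
  · intro e' s hs t' ht'
    rw [key e' s hs, key e' t' ht']
    exact hg e' s hs t' ht'

lemma abs_dist_param_sub_le (e : M.E) (y : G) {s t : ℝ} (hs : s ∈ Icc 0 (M.len e))
    (ht : t ∈ Icc 0 (M.len e)) :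
    |dist (M.param e s) y - dist (M.param e t) y| ≤ |s - t| :=
  (abs_dist_sub_le _ _ _).trans (M.dist_param_le e hs ht)

lemma dist_src_le (e : M.E) {s : ℝ} (hs : s ∈ Icc 0 (M.len e)) :
    dist (M.src e) (M.param e s) ≤ s := by
  have := M.dist_param_le e (M.zero_mem e) hs
  rwa [zero_sub, abs_neg, abs_of_nonneg hs.1] at this

lemma dist_tgt_le (e : M.E) {s : ℝ} (hs : s ∈ Icc 0 (M.len e)) :
    dist (M.tgt e) (M.param e s) ≤ M.len e - s := by
  have := M.dist_param_le e (M.len_mem e) hs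
  rwa [abs_of_nonneg (by linarith [hs.2])] at this

lemma dist_src_tgt_le (e : M.E) : dist (M.src e) (M.tgt e) ≤ M.len e :=
  M.dist_src_le e (M.len_mem e)

/-- Leaving an edge means passing through one of its endpoints. -/
lemma exit_le {e : M.E} {p : ℝ} (hp : p ∈ Icc 0 (M.len e)) {y' : G} (hy' : y' ∉ M.openEdge e) :
    p + dist (M.src e) y' ≤ dist (M.param e p) y' ∨
      (M.len e - p) + dist (M.tgt e) y' ≤ dist (M.param e p) y' := by
  classical
  have hst := M.dist_src_tgt_le e
  have t1 := dist_triangle (M.src e) (M.tgt e) y'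
  have t2 := dist_triangle_left (M.tgt e) y' (M.src e)
  obtain ⟨φ, hφ, hv, hL⟩ := M.exists_glue (fun v => dist v y')
    (fun e' s => if e' = e then
      min (s + dist (M.src e) y') ((M.len e - s) + dist (M.tgt e) y')
      else dist (M.param e' s) y') (by
      intro e'
      split_ifs with h
      · subst h
        rw [zero_add, sub_zero, min_eq_left (by linarith)]
      · rfl) (by
      intro e'
      split_ifs with h
      · subst h
        rw [sub_self, zero_add, min_eq_right (by linarith)]
      · rfl) (by
      intro e' s hs t ht
      split_ifs with h
      · refine (abs_min_sub_min_le_max _ _ _ _).trans (max_le ?_ ?_)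
        · rw [add_sub_add_right_eq_sub]
        · rw [add_sub_add_right_eq_sub, sub_sub_sub_cancel_left, abs_sub_comm]
      · exact M.abs_dist_param_sub_le e' y' hs ht)
  have h0 : φ y' = 0 := by
    obtain ⟨e', s, hs, rfl⟩ := M.exists_mem_edge y'
    by_cases h : e' = e
    · subst h
      have hv' : M.param e' s ∈ M.vertexSet := by
        rcases M.eq_or_mem_Ioo hs with rfl | rfl | h
        · exact ⟨e', .inl rfl⟩
        · exact ⟨e', .inr rfl⟩
        · exact absurd ⟨s, h, rfl⟩ hy'
      rw [hv _ hv', dist_self]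
    · rw [hφ e' s hs, if_neg h, dist_self]
  have := (le_abs_self _).trans (hL (M.param e p) y')
  rw [h0, hφ e p hp, if_pos rfl, sub_zero] at this
  exact min_le_iff.1 this

/-- A vertex all of whose incident edges are longer than `τ` is at distance at least `τ` from
the edges it does not belong to and from the other vertices. -/
lemma le_dist_of_forall_lt_len {τ : ℝ} (hτ : 0 ≤ τ) {u : G} (hu : u ∈ M.vertexSet)
    (hlen : ∀ e, M.src e = u ∨ M.tgt e = u → τ < M.len e) :
    (∀ e, M.src e ≠ u → M.tgt e ≠ u → ∀ y ∈ M.edge e, τ ≤ dist u y) ∧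
      ∀ v ∈ M.vertexSet, v ≠ u → τ ≤ dist u v := by
  classical
  obtain ⟨φ, hφ, hv, hL⟩ := M.exists_glue (fun v => if v = u then 0 else τ)
    (fun e s => min τ (min ((if M.src e = u then 0 else τ) + s)
      ((if M.tgt e = u then 0 else τ) + (M.len e - s)))) (by
      intro e
      have := M.len_pos e
      have := hlen e
      split_ifs with h1 h2 h2 <;> simp [h1, h2] at this <;> grind) (by
      intro e
      have := M.len_pos e
      have := hlen e
      split_ifs with h1 h2 h2 <;> simp [h1, h2] at this <;> grind) (by
      intro e s hs t ht
      refine (abs_min_sub_min_le_max _ _ _ _).trans (max_le (by simp) ?_)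
      refine (abs_min_sub_min_le_max _ _ _ _).trans (max_le ?_ ?_)
      · rw [add_sub_add_left_eq_sub]
      · rw [add_sub_add_left_eq_sub, sub_sub_sub_cancel_left, abs_sub_comm])
  have hu0 : φ u = 0 := by rw [hv u hu, if_pos rfl]
  constructor
  · rintro e h1 h2 _ ⟨s, hs, rfl⟩
    have := (neg_le_abs _).trans (hL u (M.param e s))
    rw [hu0, hφ e s hs, if_neg h1, if_neg h2] at this
    have : min τ (min (τ + s) (τ + (M.len e - s))) = τ :=
      min_eq_left (le_min (by linarith [hs.1]) (by linarith [hs.2]))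
    linarith
  · intro v hv' hne
    have := (neg_le_abs _).trans (hL u v)
    rw [hu0, hv v hv', if_neg hne] at this
    linarith

/-- The same graph with all edges reversed. -/
def reverse : MetricGraphStruct G where
  E := M.E
  fintypeE := M.fintypeE
  len := M.len
  len_pos := M.len_pos
  param e s := M.param e (M.len e - s)
  param_lipschitz e := by
    refine LipschitzOnWith.of_dist_le_mul fun s hs t ht => ?_
    have := M.dist_param_le e (s := M.len e - s) (t := M.len e - t)
      ⟨by linarith [hs.2], by linarith [hs.1]⟩ ⟨by linarith [ht.2], by linarith [ht.1]⟩
    rw [sub_sub_sub_cancel_left, abs_sub_comm] at this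
    simpa [Real.dist_eq] using this
  cover y := by
    obtain ⟨e, t, ht, h⟩ := M.cover y
    exact ⟨e, M.len e - t, ⟨by linarith [ht.2], by linarith [ht.1]⟩, by simpa using h⟩
  injOn e s hs t ht h := by
    have := M.injOn e (x₁ := M.len e - s) (x₂ := M.len e - t)
      ⟨by linarith [hs.2], by linarith [hs.1]⟩ ⟨by linarith [ht.2], by linarith [ht.1]⟩ h
    linarith
  disjoint_interiors e₁ e₂ hne s hs t ht := M.disjoint_interiors e₁ e₂ hne _
      ⟨by linarith [hs.2], by linarith [hs.1]⟩ _ ⟨by linarith [ht.2], by linarith [ht.1]⟩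
  endpoint_not_interior e e' t ht := by
    have := M.endpoint_not_interior e e' (M.len e' - t)
      ⟨by linarith [ht.2], by linarith [ht.1]⟩
    simpa using this.symm
  dist_maximal δ h1 h2 h3 h4 := by
    refine M.dist_maximal δ h1 h2 h3 fun e s hs t ht => ?_
    have := h4 e (M.len e - s) ⟨by linarith [hs.2], by linarith [hs.1]⟩ (M.len e - t)
      ⟨by linarith [ht.2], by linarith [ht.1]⟩
    simp only [sub_sub_cancel, sub_sub_sub_cancel_left] at this
    rwa [abs_sub_comm]

lemma reverse_src (e : M.E) : M.reverse.src e = M.tgt e := by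
  simp [src, tgt, reverse]

lemma reverse_tgt (e : M.E) : M.reverse.tgt e = M.src e := by
  simp [src, tgt, reverse]

lemma reverse_edge (e : M.E) : M.reverse.edge e = M.edge e := by
  ext y
  have hl : M.reverse.len e = M.len e := rfl
  constructor
  · rintro ⟨s, hs, rfl⟩
    exact ⟨M.len e - s, ⟨by linarith [hs.2, hl], by linarith [hs.1, hl]⟩, rfl⟩
  · rintro ⟨s, hs, rfl⟩
    exact ⟨M.len e - s, ⟨by linarith [hs.2, hl], by linarith [hs.1, hl]⟩, by simp [reverse]⟩

/-- The subdivision of a metric graph at an interior point of the edge `e₀`. -/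
noncomputable def subdivide (e₀ : M.E) {p : ℝ} (hp : p ∈ Ioo 0 (M.len e₀)) :
    MetricGraphStruct G := by
  classical
  exact
  { E := Option M.E
    fintypeE := by have := M.fintypeE; infer_instance
    len := fun o => o.elim (M.len e₀ - p) fun e => if e = e₀ then p else M.len e
    len_pos := by
      rintro (_ | e)
      · simpa using hp.2
      · have := M.len_pos e
        have := hp.1
        dsimp
        split_ifs <;> assumption
    param := fun o s => o.elim (M.param e₀ (p + s)) fun e => M.param e s
    param_lipschitz := by
      rintro (_ | e)
      · refine LipschitzOnWith.of_dist_le_mul fun s hs t ht => ?_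
        dsimp at hs ht
        have := M.dist_param_le e₀ (s := p + s) (t := p + t)
          ⟨by linarith [hs.1, hp.1], by linarith [hs.2]⟩
          ⟨by linarith [ht.1, hp.1], by linarith [ht.2]⟩
        rw [add_sub_add_left_eq_sub] at this
        simpa [Real.dist_eq] using this
      · refine (M.param_lipschitz e).mono (Icc_subset_Icc le_rfl ?_)
        dsimp
        split_ifs with h
        · subst h; exact hp.2.le
        · exact le_rfl
    cover := by
      intro y
      obtain ⟨e, t, ht, rfl⟩ := M.cover y
      by_cases h : e = e₀
      · subst h
        rcases le_total t p with h | h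
        · exact ⟨some e, t, by simpa using ⟨ht.1, h⟩, rfl⟩
        · exact ⟨none, t - p, ⟨by linarith, by dsimp; linarith [ht.2]⟩, by simp⟩
      · exact ⟨some e, t, by simpa [h] using ht, rfl⟩
    injOn := by
      rintro (_ | e) s hs t ht h
      · dsimp at hs ht h
        have := M.injOn e₀ ⟨by linarith [hs.1, hp.1], by linarith [hs.2]⟩
          ⟨by linarith [ht.1, hp.1], by linarith [ht.2]⟩ h
        linarith
      · have : (if e = e₀ then p else M.len e) ≤ M.len e := by
          split_ifs with h
          · subst h; exact hp.2.le
          · exact le_rfl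
        exact M.injOn e ⟨hs.1, hs.2.trans_le this⟩ ⟨ht.1, ht.2.trans_le this⟩ h
    disjoint_interiors := by
      have hle : ∀ e, (if e = e₀ then p else M.len e) ≤ M.len e := by
        intro e
        split_ifs with h
        · subst h; exact hp.2.le
        · exact le_rfl
      have key : ∀ e, ∀ s ∈ Ioo 0 (if e = e₀ then p else M.len e),
          ∀ t ∈ Ioo 0 (M.len e₀ - p), M.param e s ≠ M.param e₀ (p + t) := by
        intro e s hs t ht heq
        rcases M.param_eq_param ⟨hs.1.le, hs.2.le.trans (hle e)⟩
          (s' := p + t) ⟨by linarith [ht.1, hp.1], by linarith [ht.2]⟩ heq with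
          ⟨rfl, rfl⟩ | ⟨h, -⟩
        · simp only [if_true] at hs
          linarith [hs.2, ht.1]
        · rcases h with rfl | rfl
          · exact absurd hs.1 (lt_irrefl _)
          · exact absurd (hs.2.trans_le (hle e)) (lt_irrefl _)
      rintro (_ | e₁) (_ | e₂) hne s hs t ht
      · exact absurd rfl hne
      · exact (key e₂ t ht s hs).symm
      · exact key e₁ s hs t ht
      · exact M.disjoint_interiors e₁ e₂ (fun h => hne (by rw [h])) s
          ⟨hs.1, hs.2.trans_le (hle e₁)⟩ t ⟨ht.1, ht.2.trans_le (hle e₂)⟩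
    endpoint_not_interior := by
      have hle : ∀ e, (if e = e₀ then p else M.len e) ≤ M.len e := by
        intro e
        split_ifs with h
        · subst h; exact hp.2.le
        · exact le_rfl
      have hp' : p ∈ Icc 0 (M.len e₀) := Ioo_subset_Icc_self hp
      have key1 : ∀ e', ∀ t ∈ Ioo 0 (if e' = e₀ then p else M.len e'),
          M.param e₀ p ≠ M.param e' t ∧ ∀ e, M.param e 0 ≠ M.param e' t ∧
            M.param e (M.len e) ≠ M.param e' t := by
        intro e' t ht
        have ht' : t ∈ Ioo 0 (M.len e') := ⟨ht.1, ht.2.trans_le (hle e')⟩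
        refine ⟨fun heq => ?_, fun e => M.endpoint_not_interior e e' t ht'⟩
        rcases M.param_eq_param hp' (Ioo_subset_Icc_self ht') heq with ⟨rfl, rfl⟩ | ⟨-, h | h⟩
        · simp at ht
        · exact ht'.1.ne' h
        · exact ht'.2.ne h
      have key2 : ∀ t ∈ Ioo 0 (M.len e₀ - p),
          M.param e₀ p ≠ M.param e₀ (p + t) ∧ ∀ e, M.param e 0 ≠ M.param e₀ (p + t) ∧
            M.param e (M.len e) ≠ M.param e₀ (p + t) := by
        intro t ht
        have ht' : p + t ∈ Ioo 0 (M.len e₀) := ⟨by linarith [ht.1, hp.1], by linarith [ht.2]⟩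
        refine ⟨fun heq => ?_, fun e => M.endpoint_not_interior e e₀ _ ht'⟩
        have := M.injOn e₀ hp ht' heq
        linarith [ht.1]
      have ends : ∀ o : Option M.E, ∀ y : G, (M.param e₀ p ≠ y ∧
          ∀ e, M.param e 0 ≠ y ∧ M.param e (M.len e) ≠ y) →
          (o.elim (M.param e₀ (p + 0)) fun e => M.param e 0) ≠ y ∧
          (o.elim (M.param e₀ (p + (o.elim (M.len e₀ - p)
            fun e => if e = e₀ then p else M.len e))) fun e => M.param e (o.elim (M.len e₀ - p)
            fun e => if e = e₀ then p else M.len e)) ≠ y := by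
        rintro (_ | e) y ⟨h1, h2⟩
        · simpa using ⟨h1, (h2 e₀).2⟩
        · dsimp
          split_ifs with h
          · subst h; exact ⟨(h2 e).1, h1⟩
          · exact h2 e
      rintro o (_ | e') t ht
      · exact ends o _ (key2 t ht)
      · exact ends o _ (key1 e' t ht)
    dist_maximal := by
      intro δ h1 h2 h3 h4
      have hlt : ∀ s ∈ Icc 0 (M.len e₀), ∀ t ∈ Icc 0 (M.len e₀), s ≤ t →
          δ (M.param e₀ s) (M.param e₀ t) ≤ t - s := by
        have hl : ∀ s ∈ Icc 0 p, ∀ t ∈ Icc 0 p, s ≤ t →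
            δ (M.param e₀ s) (M.param e₀ t) ≤ t - s := by
          intro s hs t ht hst
          have := h4 (some e₀) s (by simpa using hs) t (by simpa using ht)
          rwa [abs_of_nonpos (by linarith), neg_sub] at this
        have hr : ∀ s ∈ Icc p (M.len e₀), ∀ t ∈ Icc p (M.len e₀), s ≤ t →
            δ (M.param e₀ s) (M.param e₀ t) ≤ t - s := by
          intro s hs t ht hst
          have := h4 none (s - p) ⟨by linarith [hs.1], by dsimp; linarith [hs.2]⟩ (t - p)
            ⟨by linarith [ht.1], by dsimp; linarith [ht.2]⟩
          dsimp at this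
          rw [add_sub_cancel, add_sub_cancel, abs_of_nonpos (by linarith)] at this
          linarith
        intro s hs t ht hst
        rcases le_total t p with h | h
        · exact hl s ⟨hs.1, hst.trans h⟩ t ⟨ht.1, h⟩ hst
        · rcases le_total s p with h' | h'
          · have a1 := hl s ⟨hs.1, h'⟩ p ⟨hp.1.le, le_rfl⟩ h'
            have a2 := hr p ⟨le_rfl, hp.2.le⟩ t ⟨h, ht.2⟩ h
            linarith [h3 (M.param e₀ s) (M.param e₀ p) (M.param e₀ t)]
          · exact hr s ⟨h', hs.2⟩ t ⟨h, ht.2⟩ hst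
      refine M.dist_maximal δ h1 h2 h3 fun e s hs t ht => ?_
      by_cases h : e = e₀
      · subst h
        rcases le_total s t with h | h
        · rw [abs_of_nonpos (by linarith), neg_sub]
          exact hlt s hs t ht h
        · rw [abs_of_nonneg (by linarith), h2]
          exact hlt t ht s hs h
      · exact h4 (some e) s (by simpa [h] using hs) t (by simpa [h] using ht) }

/-- The number of edges of length at most `τ` not incident to `y`. -/
noncomputable def shortEdges (τ : ℝ) (y : G) : ℕ :=
  Nat.card {e : M.E // M.len e ≤ τ ∧ M.src e ≠ y ∧ M.tgt e ≠ y}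

lemma shortEdges_le_NE (τ : ℝ) (y : G) : M.shortEdges τ y ≤ M.NE τ := by
  have := M.fintypeE
  exact Nat.card_le_card_of_injective (fun e => (⟨e.1, e.2.1⟩ : {e : M.E // M.len e ≤ τ}))
    fun a b h => by simpa [Subtype.ext_iff] using h

/-- Every point of a metric graph can be made a vertex. -/
lemma exists_subdivision {y : G} (hy : y ∉ M.vertexSet) :
    ∃ M₁ : MetricGraphStruct G, M₁.vertexSet = insert y M.vertexSet ∧
      ∀ τ, M₁.shortEdges τ y ≤ M.NE τ := by
  classical
  obtain ⟨e₀, hye⟩ := M.exists_mem_edge y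
  have hyo : y ∈ M.openEdge e₀ := by
    rcases M.mem_edge_cases hye with rfl | rfl | h
    exacts [absurd (M.src_mem_vertexSet e₀) hy, absurd (M.tgt_mem_vertexSet e₀) hy, h]
  obtain ⟨p, hp, rfl⟩ := hyo
  have hs : ∀ e : M.E, (M.subdivide e₀ hp).src (some e) = M.src e := fun e => rfl
  have hs0 : (M.subdivide e₀ hp).src none = M.param e₀ p := by
    show M.param e₀ (p + 0) = _
    rw [add_zero]
  have ht : ∀ e : M.E, e ≠ e₀ → (M.subdivide e₀ hp).tgt (some e) = M.tgt e := by
    intro e he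
    show M.param e (if e = e₀ then p else M.len e) = _
    rw [if_neg he]; rfl
  have ht1 : (M.subdivide e₀ hp).tgt (some e₀) = M.param e₀ p := by
    show M.param e₀ (if e₀ = e₀ then p else M.len e₀) = _
    rw [if_pos rfl]
  have ht0 : (M.subdivide e₀ hp).tgt none = M.tgt e₀ := by
    show M.param e₀ (p + (M.len e₀ - p)) = _
    rw [add_sub_cancel]; rfl
  refine ⟨M.subdivide e₀ hp, ?_, fun τ => ?_⟩
  · ext v
    constructor
    · rintro ⟨_ | e, rfl | rfl⟩
      · exact .inl hs0
      · exact .inr ⟨e₀, .inr ht0⟩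
      · exact .inr ⟨e, .inl (hs e)⟩
      · by_cases h : e = e₀
        · subst h; exact .inl ht1
        · exact .inr ⟨e, .inr (ht e h)⟩
    · rintro (rfl | ⟨e, rfl | rfl⟩)
      · exact ⟨none, .inl hs0.symm⟩
      · exact ⟨some e, .inl (hs e).symm⟩
      · by_cases h : e = e₀
        · subst h; exact ⟨none, .inr ht0.symm⟩
        · exact ⟨some e, .inr (ht e h).symm⟩
  · have := M.fintypeE
    have key : ∀ o : (M.subdivide e₀ hp).E, (M.subdivide e₀ hp).len o ≤ τ →
        (M.subdivide e₀ hp).src o ≠ M.param e₀ p → (M.subdivide e₀ hp).tgt o ≠ M.param e₀ p →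
        ∃ e, M.len e ≤ τ ∧ o = some e := by
      rintro (_ | e) h1 h2 h3
      · exact absurd hs0 h2
      · by_cases h : e = e₀
        · subst h; exact absurd ht1 h3
        · refine ⟨e, ?_, rfl⟩
          have : (M.subdivide e₀ hp).len (some e) = if e = e₀ then p else M.len e := rfl
          rwa [this, if_neg h] at h1
    choose f hf1 hf2 using key
    refine Nat.card_le_card_of_injective
      (fun o => (⟨f o.1 o.2.1 o.2.2.1 o.2.2.2, hf1 _ _ _ _⟩ : {e : M.E // M.len e ≤ τ})) ?_
    intro a b h
    have h := congrArg Subtype.val h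
    dsimp at h
    have h1 := hf2 a.1 a.2.1 a.2.2.1 a.2.2.2
    have h2 := hf2 b.1 b.2.1 b.2.2.1 b.2.2.2
    rw [h] at h1
    exact Subtype.ext (h1.trans h2.symm)

end MetricGraphStruct

/-- A closed relation between two metric spaces, defined on all of the first one, of distortion
at most `D`. -/
structure ClosedCorr (X Y : Type*) [MetricSpace X] [MetricSpace Y] (D : ℝ) where
  /-- the relation -/
  rel : X → Y → Prop
  total : ∀ x, ∃ y, rel x y
  closed : IsClosed {q : X × Y | rel q.1 q.2}
  abs_sub_le : ∀ {x y x' y'}, rel x y → rel x' y' → |dist x x' - dist y y'| ≤ D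

/-- Compact metric spaces are related by a closed correspondence of distortion at most twice
their Gromov-Hausdorff distance. -/
lemma exists_closedCorr (X Y : Type*) [MetricSpace X] [MetricSpace Y] [CompactSpace X]
    [CompactSpace Y] [Nonempty X] [Nonempty Y] :
    Nonempty (ClosedCorr X Y (2 * GromovHausdorff.ghDist X Y)) := by
  obtain ⟨Φ, Ψ, hΦ, hΨ, hd⟩ := GromovHausdorff.ghDist_eq_hausdorffDist X Y
  refine ⟨⟨fun x y => dist (Φ x) (Ψ y) ≤ GromovHausdorff.ghDist X Y, fun x => ?_, ?_, ?_⟩⟩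
  · have hcX : IsCompact (range Φ) := isCompact_range hΦ.continuous
    have hcY : IsCompact (range Ψ) := isCompact_range hΨ.continuous
    obtain ⟨_, ⟨y, rfl⟩, hy⟩ := hcY.exists_infDist_eq_dist (range_nonempty Ψ) (Φ x)
    refine ⟨y, ?_⟩
    rw [← hy, hd]
    exact infDist_le_hausdorffDist_of_mem (mem_range_self x)
      (hausdorffEDist_ne_top_of_nonempty_of_bounded (range_nonempty _) (range_nonempty _)
        hcX.isBounded hcY.isBounded)
  · exact isClosed_le ((hΦ.continuous.comp continuous_fst).dist
      (hΨ.continuous.comp continuous_snd)) continuous_const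
  · intro x y x' y' h h'
    rw [← hΦ.dist_eq x x', ← hΨ.dist_eq y y', abs_le]
    have t1 := dist_triangle4 (Φ x) (Ψ y) (Ψ y') (Φ x')
    have t2 := dist_triangle4 (Ψ y) (Φ x) (Φ x') (Ψ y')
    rw [dist_comm (Ψ y') (Φ x')] at t1
    rw [dist_comm (Ψ y) (Φ x)] at t2
    constructor <;> linarith

/-- If a preconnected set is covered by the projections of two closed sets along a compact
factor, then some point of it lies in both. -/
lemma IsPreconnected.exists_mem_both {X K : Type*} [TopologicalSpace X] [TopologicalSpace K]
    [CompactSpace K] {Q : Set X} (hQ : IsPreconnected Q) {C₁ C₂ : Set (X × K)}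
    (hC₁ : IsClosed C₁) (hC₂ : IsClosed C₂)
    (h : ∀ w ∈ Q, (∃ k, (w, k) ∈ C₁) ∨ ∃ k, (w, k) ∈ C₂)
    (h₁ : ∃ w ∈ Q, ∃ k, (w, k) ∈ C₁) (h₂ : ∃ w ∈ Q, ∃ k, (w, k) ∈ C₂) :
    ∃ w ∈ Q, (∃ k, (w, k) ∈ C₁) ∧ ∃ k, (w, k) ∈ C₂ := by
  have key : ∀ (C : Set (X × K)) w, w ∈ Prod.fst '' C ↔ ∃ k, (w, k) ∈ C := by
    intro C w
    constructor
    · rintro ⟨⟨w, k⟩, h, rfl⟩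
      exact ⟨k, h⟩
    · rintro ⟨k, h⟩
      exact ⟨_, h, rfl⟩
  obtain ⟨w, hw, hw1, hw2⟩ := isPreconnected_closed_iff.1 hQ (Prod.fst '' C₁) (Prod.fst '' C₂)
    (isClosedMap_fst_of_compactSpace _ hC₁) (isClosedMap_fst_of_compactSpace _ hC₂)
    (fun w hw => (h w hw).imp (key _ _).2 (key _ _).2)
    (by obtain ⟨w, hw, h⟩ := h₁; exact ⟨w, hw, (key _ _).2 h⟩)
    (by obtain ⟨w, hw, h⟩ := h₂; exact ⟨w, hw, (key _ _).2 h⟩)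
  exact ⟨w, hw, (key _ _).1 hw1, (key _ _).1 hw2⟩

namespace ClosedCorr

variable {X Y : Type*} [MetricSpace X] [MetricSpace Y] {D : ℝ} (C : ClosedCorr X Y D)

/-- `x` is related to a point of `A`. -/
def Over (A : Set Y) (x : X) : Prop := ∃ y ∈ A, C.rel x y

/-- `x` is related to a point within `D / 2` of `v`. -/
def Touch (v : Y) (x : X) : Prop := C.Over (closedBall v (D / 2)) x

variable {C}

lemma touch_of_rel {x : X} {y v : Y} (h : C.rel x y) (hv : dist y v ≤ D / 2) : C.Touch v x :=
  ⟨y, hv, h⟩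

lemma Touch.exists_rel {x : X} {v : Y} (h : C.Touch v x) : ∃ y, C.rel x y ∧ dist y v ≤ D / 2 :=
  let ⟨y, hy, hxy⟩ := h
  ⟨y, hxy, hy⟩

lemma dist_le_of_rel {x x' : X} {y y' : Y} (h : C.rel x y) (h' : C.rel x' y') :
    dist x x' ≤ dist y y' + D := by
  linarith [(abs_le.1 (C.abs_sub_le h h')).2]

lemma dist_le_of_rel' {x x' : X} {y y' : Y} (h : C.rel x y) (h' : C.rel x' y') :
    dist y y' ≤ dist x x' + D := by
  linarith [(abs_le.1 (C.abs_sub_le h h')).1]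

lemma dist_le_of_rel_self {x : X} {y y' : Y} (h : C.rel x y) (h' : C.rel x y') :
    dist y y' ≤ D := by
  simpa using dist_le_of_rel' h h'

lemma dist_le_of_touch {x x' : X} {v v' : Y} (h : C.Touch v x) (h' : C.Touch v' x') :
    dist x x' ≤ dist v v' + 2 * D := by
  obtain ⟨y, hy, hd⟩ := h.exists_rel
  obtain ⟨y', hy', hd'⟩ := h'.exists_rel
  have := dist_le_of_rel hy hy'
  have := dist_triangle4 y v v' y'
  rw [dist_comm v' y'] at this
  linarith

lemma dist_le_of_touch_self {x : X} {v v' : Y} (h : C.Touch v x) (h' : C.Touch v' x) :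
    dist v v' ≤ 2 * D := by
  obtain ⟨y, hy, hd⟩ := h.exists_rel
  obtain ⟨y', hy', hd'⟩ := h'.exists_rel
  have := dist_le_of_rel_self hy hy'
  have := dist_triangle4 v y y' v'
  rw [dist_comm v y] at this
  linarith

lemma dist_le_of_rel_touch {x x' : X} {y v : Y} (h : C.rel x y) (h' : C.Touch v x') :
    dist x x' ≤ dist y v + 3 / 2 * D := by
  obtain ⟨y', hy', hd'⟩ := h'.exists_rel
  have := dist_le_of_rel h hy'
  have := dist_triangle_right y y' v
  linarith

lemma dist_le_of_rel_touch' {x x' : X} {y v : Y} (h : C.rel x y) (h' : C.Touch v x') :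
    dist y v ≤ dist x x' + 3 / 2 * D := by
  obtain ⟨y', hy', hd'⟩ := h'.exists_rel
  have := dist_le_of_rel' h hy'
  have := dist_triangle y y' v
  linarith

lemma isClosed_over [CompactSpace Y] {A : Set Y} (hA : IsClosed A) :
    IsClosed {x | C.Over A x} := by
  have h : IsClosed ({q : X × Y | C.rel q.1 q.2} ∩ Prod.snd ⁻¹' A) :=
    C.closed.inter (hA.preimage continuous_snd)
  have := isClosedMap_fst_of_compactSpace _ h
  convert this using 1
  ext x
  constructor
  · rintro ⟨y, hy, hxy⟩
    exact ⟨(x, y), ⟨hxy, hy⟩, rfl⟩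
  · rintro ⟨⟨x, y⟩, ⟨hxy, hy⟩, rfl⟩
    exact ⟨y, hy, hxy⟩

lemma isClosed_touch [CompactSpace Y] (v : Y) : IsClosed {x | C.Touch v x} :=
  isClosed_over isClosed_closedBall

variable (C) in
lemma over_or_over {A B : Set Y} (hAB : A ∪ B = univ) (x : X) : C.Over A x ∨ C.Over B x := by
  obtain ⟨y, hy⟩ := C.total x
  have : y ∈ A ∪ B := by rw [hAB]; trivial
  exact this.imp (fun h => ⟨y, h, hy⟩) fun h => ⟨y, h, hy⟩

lemma exists_over_both [CompactSpace Y] {Q : Set X} (hQ : IsPreconnected Q) {A B : Set Y}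
    (hA : IsClosed A) (hB : IsClosed B) (hAB : A ∪ B = univ)
    (h₁ : ∃ w ∈ Q, C.Over A w) (h₂ : ∃ w ∈ Q, C.Over B w) :
    ∃ w ∈ Q, C.Over A w ∧ C.Over B w :=
  isPreconnected_closed_iff.1 hQ _ _ (isClosed_over hA) (isClosed_over hB)
    (fun w _ => C.over_or_over hAB w) h₁ h₂

/-- Descending from a point over `A` to the base point over `B`, one meets a point over both. -/
lemma exists_descent_over_both [CompactSpace Y] (hX : IsGeodesicSpace X) {r w : X} {A B : Set Y}
    (hA : IsClosed A) (hB : IsClosed B) (hAB : A ∪ B = univ)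
    (hw : C.Over A w) (hr : C.Over B r) :
    ∃ z, IsDescent r w z ∧ C.Over A z ∧ C.Over B z := by
  obtain ⟨γ, γc, γ0, γ1, γd, γD⟩ := (IsDescent.base r w).exists_path hX
  have hL : (0 : ℝ) ≤ dist r w - dist r r := by simp
  obtain ⟨_, ⟨s, hs, rfl⟩, h1, h2⟩ := exists_over_both
    (isPreconnected_Icc.image γ γc.continuousOn) hA hB hAB
    ⟨_, ⟨0, ⟨le_rfl, hL⟩, rfl⟩, by rwa [γ0]⟩ ⟨_, ⟨_, ⟨hL, le_rfl⟩, rfl⟩, by rwa [γ1]⟩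
  refine ⟨γ s, ?_, h1, h2⟩
  have := γD 0 ⟨le_rfl, hL⟩ s hs hs.1
  rwa [γ0] at this

lemma nonneg_of_switch [CompactSpace X] [CompactSpace Y] {Q : Set X} (hQ : IsPreconnected Q)
    {φ : Y → ℝ} (hφ : ∀ p q, |φ p - φ q| ≤ dist p q) {A₁ A₂ : ℝ}
    (h : ∀ w ∈ Q, (∃ z y, C.rel z y ∧ φ y + dist w z ≤ A₁) ∨
      ∃ z y, C.rel z y ∧ -φ y + dist w z ≤ A₂)
    (h₁ : ∃ w ∈ Q, ∃ z y, C.rel z y ∧ φ y + dist w z ≤ A₁)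
    (h₂ : ∃ w ∈ Q, ∃ z y, C.rel z y ∧ -φ y + dist w z ≤ A₂) : 0 ≤ A₁ + A₂ + D := by
  have hφc : Continuous φ := by
    refine LipschitzWith.continuous (K := 1) (LipschitzWith.of_dist_le_mul fun p q => ?_)
    simpa [Real.dist_eq] using hφ p q
  have hcl : IsClosed {q : X × X × Y | C.rel q.2.1 q.2.2} := C.closed.preimage continuous_snd
  have h1c : IsClosed {q : X × X × Y | C.rel q.2.1 q.2.2 ∧ φ q.2.2 + dist q.1 q.2.1 ≤ A₁} :=
    hcl.inter (isClosed_le (f := fun q : X × X × Y => φ q.2.2 + dist q.1 q.2.1) (by fun_prop)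
      continuous_const)
  have h2c : IsClosed {q : X × X × Y | C.rel q.2.1 q.2.2 ∧ -φ q.2.2 + dist q.1 q.2.1 ≤ A₂} :=
    hcl.inter (isClosed_le (f := fun q : X × X × Y => -φ q.2.2 + dist q.1 q.2.1) (by fun_prop)
      continuous_const)
  obtain ⟨w, -, ⟨⟨z, y⟩, hzy, hA1⟩, ⟨z', y'⟩, hzy', hA2⟩ := hQ.exists_mem_both h1c h2c
    (fun w hw => (h w hw).imp (fun ⟨z, y, h⟩ => ⟨(z, y), h⟩) fun ⟨z, y, h⟩ => ⟨(z, y), h⟩)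
    (let ⟨w, hw, z, y, h⟩ := h₁; ⟨w, hw, (z, y), h⟩)
    (let ⟨w, hw, z, y, h⟩ := h₂; ⟨w, hw, (z, y), h⟩)
  dsimp at hzy hzy' hA1 hA2
  have := dist_le_of_rel' hzy hzy'
  have := dist_triangle_left z z' w
  have := (abs_le.1 (hφ y y')).1
  linarith

variable {M : MetricGraphStruct Y}

lemma touch_end_of_rel {e : M.E} {x : X} {y' : Y} (h : C.Over (M.edge e) x) (h' : C.rel x y')
    (hy' : y' ∉ M.openEdge e) : C.Touch (M.src e) x ∨ C.Touch (M.tgt e) x := by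
  obtain ⟨_, ⟨p, hp, rfl⟩, hxp⟩ := h
  have hD := dist_le_of_rel_self hxp h'
  have h1 := M.dist_src_le e hp
  have h2 := M.dist_tgt_le e hp
  rw [dist_comm] at h1 h2
  rcases M.exit_le hp hy' with h | h
  · left
    rcases le_total p (D / 2) with hpD | hpD
    · exact touch_of_rel hxp (h1.trans hpD)
    · exact touch_of_rel h' (by rw [dist_comm]; linarith)
  · right
    rcases le_total (M.len e - p) (D / 2) with hpD | hpD
    · exact touch_of_rel hxp (h2.trans hpD)
    · exact touch_of_rel h' (by rw [dist_comm]; linarith)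

lemma touch_end_of_touch {e : M.E} {x : X} {v : Y} (h : C.Over (M.edge e) x) (hv : C.Touch v x)
    (hvV : v ∈ M.vertexSet) : C.Touch (M.src e) x ∨ C.Touch (M.tgt e) x := by
  obtain ⟨y', hy', hd⟩ := hv.exists_rel
  by_cases hmem : y' ∈ M.openEdge e
  · obtain ⟨p, hp, rfl⟩ := hmem
    have hp := Ioo_subset_Icc_self hp
    have h1 := M.dist_src_le e hp
    have h2 := M.dist_tgt_le e hp
    rw [dist_comm] at h1 h2
    have h3 := dist_nonneg (x := M.src e) (y := v)
    have h4 := dist_nonneg (x := M.tgt e) (y := v)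
    rcases M.exit_le hp (M.notMem_openEdge_of_mem_vertexSet hvV e) with h | h
    · exact .inl (touch_of_rel hy' (by linarith))
    · exact .inr (touch_of_rel hy' (by linarith))
  · exact touch_end_of_rel h hy' hmem

lemma anchor_src {e : M.E} {x : X} (h : C.Over (M.edge e) x) (hv : C.Touch (M.src e) x) :
    (∃ p ∈ Icc 0 (M.len e), p ≤ D ∧ C.rel x (M.param e p)) ∨ C.Touch (M.tgt e) x := by
  obtain ⟨y', hy', hd⟩ := hv.exists_rel
  have hD : 0 ≤ D := by linarith [dist_nonneg (x := y') (y := M.src e)]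
  by_cases hmem : y' ∈ M.edge e
  · obtain ⟨p, hp, rfl⟩ := hmem
    rcases M.eq_or_mem_Ioo hp with rfl | rfl | hp'
    · exact .inl ⟨0, hp, hD, hy'⟩
    · exact .inr (touch_of_rel hy' (by
        rw [show M.param e (M.len e) = M.tgt e from rfl, dist_self]; linarith))
    · have h2 := M.dist_tgt_le e hp
      rw [dist_comm] at h2
      have h3 := dist_nonneg (x := M.src e) (y := M.src e)
      have h4 := dist_nonneg (x := M.tgt e) (y := M.src e)
      rcases M.exit_le hp
        (M.notMem_openEdge_of_mem_vertexSet (M.src_mem_vertexSet e) e) with h | h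
      · exact .inl ⟨p, hp, by linarith, hy'⟩
      · exact .inr (touch_of_rel hy' (by linarith))
  · obtain ⟨_, ⟨p, hp, rfl⟩, hxp⟩ := h
    have hD' := dist_le_of_rel_self hxp hy'
    have h2 := M.dist_tgt_le e hp
    rw [dist_comm] at h2
    rcases M.exit_le hp (fun h => hmem (M.openEdge_subset_edge e h)) with h | h
    · exact .inl ⟨p, hp, by linarith [dist_nonneg (x := M.src e) (y := y')], hxp⟩
    · right
      rcases le_total (M.len e - p) (D / 2) with hpD | hpD
      · exact touch_of_rel hxp (h2.trans hpD)
      · exact touch_of_rel hy' (by rw [dist_comm]; linarith)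

lemma anchor_tgt {e : M.E} {x : X} (h : C.Over (M.edge e) x) (hv : C.Touch (M.tgt e) x) :
    (∃ p ∈ Icc 0 (M.len e), M.len e - p ≤ D ∧ C.rel x (M.param e p)) ∨ C.Touch (M.src e) x := by
  have := anchor_src (C := C) (M := M.reverse) (e := e) (x := x) (by rwa [M.reverse_edge])
    (by rwa [M.reverse_src])
  rw [M.reverse_tgt] at this
  refine this.imp_left ?_
  rintro ⟨p, hp, hpD, h⟩
  exact ⟨M.len e - p, ⟨by have := hp.2; exact sub_nonneg.2 this, by linarith [hp.1]⟩,
    by linarith, h⟩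

variable (M) in
/-- A path touching both a vertex of `A` and a vertex outside `A` crosses from `A` to its
complement, either at a point or along an edge. -/
lemma exists_crossing [CompactSpace Y] {c : ℝ → X} (hc : Continuous c) (A : Set Y)
    (hA : ∃ s ∈ Icc (0 : ℝ) 1, ∃ a ∈ M.vertexSet, a ∈ A ∧ C.Touch a (c s))
    (hB : ∃ s ∈ Icc (0 : ℝ) 1, ∃ b ∈ M.vertexSet, b ∉ A ∧ C.Touch b (c s)) :
    (∃ s ∈ Icc (0 : ℝ) 1, ∃ a ∈ M.vertexSet, ∃ b ∈ M.vertexSet, a ∈ A ∧ b ∉ A ∧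
      C.Touch a (c s) ∧ C.Touch b (c s)) ∨
    ∃ e, ∃ Q ⊆ c '' Icc 0 1, IsPreconnected Q ∧ (∀ w ∈ Q, C.Over (M.edge e) w) ∧
      (∃ w ∈ Q, C.Touch (M.src e) w) ∧ (∃ w ∈ Q, C.Touch (M.tgt e) w) ∧
      (M.src e ∈ A ∧ M.tgt e ∉ A ∨ M.src e ∉ A ∧ M.tgt e ∈ A) := by
  refine or_iff_not_imp_left.2 fun hno => ?_
  have hT : ∀ P : Y → Prop, IsCompact {s | s ∈ Icc (0 : ℝ) 1 ∧
      ∃ a ∈ M.vertexSet, P a ∧ C.Touch a (c s)} := by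
    intro P
    have : IsClosed (⋃ a ∈ {a | a ∈ M.vertexSet ∧ P a}, c ⁻¹' {x | C.Touch a x}) :=
      (M.finite_vertexSet.subset fun a h => h.1).isClosed_biUnion
        fun a _ => (isClosed_touch a).preimage hc
    convert (isCompact_Icc (a := (0 : ℝ)) (b := 1)).inter_right this using 1
    ext s
    simp [and_assoc]
  obtain ⟨⟨sA, sB⟩, ⟨⟨hsA, a, haV, haA, ha⟩, ⟨hsB, b, hbV, hbA, hb⟩⟩, hmin⟩ :=
    ((hT (· ∈ A)).prod (hT (· ∉ A))).exists_isMinOn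
      (by
        obtain ⟨s, hs, h⟩ := hA
        obtain ⟨s', hs', h'⟩ := hB
        exact ⟨(s, s'), ⟨hs, h⟩, ⟨hs', h'⟩⟩)
      (f := fun q : ℝ × ℝ => |q.1 - q.2|) (by fun_prop)
  dsimp at hsA ha hsB hb
  have hne : sA ≠ sB := by
    rintro rfl
    exact hno ⟨sA, hsA, a, haV, b, hbV, haA, hbA, ha, hb⟩
  have hlt : min sA sB < max sA sB := min_lt_max.2 hne
  have hsub : Icc (min sA sB) (max sA sB) ⊆ Icc 0 1 := fun s hs =>
    ⟨(le_min hsA.1 hsB.1).trans hs.1, hs.2.trans (max_le hsA.2 hsB.2)⟩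
  have hnone : ∀ s ∈ Ioo (min sA sB) (max sA sB), ∀ v ∈ M.vertexSet, ¬ C.Touch v (c s) := by
    intro s hs v hv hvs
    have hs01 := hsub (Ioo_subset_Icc_self hs)
    by_cases hvA : v ∈ A
    · have := hmin (show (s, sB) ∈ _ from ⟨⟨hs01, v, hv, hvA, hvs⟩, ⟨hsB, b, hbV, hbA, hb⟩⟩)
      dsimp at this
      rcases lt_or_gt_of_ne hne with h | h
      · rw [min_eq_left h.le, max_eq_right h.le] at hs
        rw [abs_of_neg (by linarith), abs_of_neg (by linarith [hs.2])] at this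
        linarith [hs.1]
      · rw [min_eq_right h.le, max_eq_left h.le] at hs
        rw [abs_of_pos (by linarith), abs_of_pos (by linarith [hs.1])] at this
        linarith [hs.2]
    · have := hmin (show (sA, s) ∈ _ from ⟨⟨hsA, a, haV, haA, ha⟩, ⟨hs01, v, hv, hvA, hvs⟩⟩)
      dsimp at this
      rcases lt_or_gt_of_ne hne with h | h
      · rw [min_eq_left h.le, max_eq_right h.le] at hs
        rw [abs_of_neg (by linarith), abs_of_neg (by linarith [hs.1])] at this
        linarith [hs.2]
      · rw [min_eq_right h.le, max_eq_left h.le] at hs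
        rw [abs_of_pos (by linarith), abs_of_pos (by linarith [hs.2])] at this
        linarith [hs.1]
  obtain ⟨s₀, hs₀⟩ := exists_between hlt
  obtain ⟨y₀, hy₀⟩ := C.total (c s₀)
  obtain ⟨e, he⟩ := M.exists_mem_edge y₀
  have hover : ∀ s ∈ Ioo (min sA sB) (max sA sB), C.Over (M.edge e) (c s) := by
    intro s hs
    by_contra hcon
    have hB' : C.Over (M.openEdge e)ᶜ (c s) :=
      (C.over_or_over (M.edge_union_compl_openEdge e) (c s)).resolve_left hcon
    obtain ⟨_, ⟨u, hu, rfl⟩, h1, y', hy', h2⟩ := exists_over_both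
      (isPreconnected_Ioo.image c hc.continuousOn)
      (M.isClosed_edge e) (M.isOpen_openEdge e).isClosed_compl (M.edge_union_compl_openEdge e)
      ⟨_, ⟨s₀, hs₀, rfl⟩, y₀, he, hy₀⟩ ⟨_, ⟨s, hs, rfl⟩, hB'⟩
    rcases touch_end_of_rel h1 h2 hy' with h | h
    · exact hnone u hu _ (M.src_mem_vertexSet e) h
    · exact hnone u hu _ (M.tgt_mem_vertexSet e) h
  have hover' : ∀ s ∈ Icc (min sA sB) (max sA sB), C.Over (M.edge e) (c s) := by
    have hcl : IsClosed {s | C.Over (M.edge e) (c s)} :=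
      (isClosed_over (M.isClosed_edge e)).preimage hc
    have := closure_minimal hover hcl
    rwa [closure_Ioo hlt.ne] at this
  have hmA : sA ∈ Icc (min sA sB) (max sA sB) := ⟨min_le_left _ _, le_max_left _ _⟩
  have hmB : sB ∈ Icc (min sA sB) (max sA sB) := ⟨min_le_right _ _, le_max_right _ _⟩
  have hA' : ∀ v ∈ M.vertexSet, C.Touch v (c sA) → v ∈ A := by
    intro v hv hvt
    by_contra hvA
    exact hno ⟨sA, hsA, a, haV, v, hv, haA, hvA, ha, hvt⟩
  have hB' : ∀ v ∈ M.vertexSet, C.Touch v (c sB) → v ∉ A := by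
    intro v hv hvt hvA
    exact hno ⟨sB, hsB, v, hv, b, hbV, hvA, hbA, hvt, hb⟩
  refine ⟨e, c '' Icc (min sA sB) (max sA sB), image_mono hsub,
    isPreconnected_Icc.image c hc.continuousOn, ?_, ?_⟩
  · rintro _ ⟨s, hs, rfl⟩
    exact hover' s hs
  have hSV := M.src_mem_vertexSet e
  have hTV := M.tgt_mem_vertexSet e
  rcases touch_end_of_touch (hover' sA hmA) ha haV with h | h <;>
  rcases touch_end_of_touch (hover' sB hmB) hb hbV with h' | h'
  · exact absurd (hA' _ hSV h) (hB' _ hSV h')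
  · exact ⟨⟨_, ⟨sA, hmA, rfl⟩, h⟩, ⟨_, ⟨sB, hmB, rfl⟩, h'⟩, .inl ⟨hA' _ hSV h, hB' _ hTV h'⟩⟩
  · exact ⟨⟨_, ⟨sB, hmB, rfl⟩, h'⟩, ⟨_, ⟨sA, hmA, rfl⟩, h⟩, .inr ⟨hB' _ hSV h', hA' _ hTV h⟩⟩
  · exact absurd (hA' _ hTV h) (hB' _ hTV h')

/-- Bracketing of a point leaving the edge `e` near its source. -/
lemma exists_rel_near_src {e : M.E} {z xa : X} {p pa : ℝ} {y' : Y}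
    (hp : p ∈ Icc 0 (M.len e)) (hz : C.rel z (M.param e p)) (hz' : C.rel z y')
    (hsum : p + dist (M.src e) y' ≤ D) (hpa : pa ∈ Icc 0 (M.len e)) (hpaD : pa ≤ D)
    (hxa : C.rel xa (M.param e pa)) :
    ∃ y, C.rel z y ∧ dist (M.src e) y + dist z xa ≤ 2 * D := by
  have h1 := M.dist_src_le e hp
  have h2 := M.dist_param_le e hp hpa
  have h3 := dist_le_of_rel hz hxa
  have h4 := dist_le_of_rel hz' hxa
  have h5 := M.dist_src_le e hpa
  have h6 := dist_triangle_left y' (M.param e pa) (M.src e)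
  rcases le_total p pa with h | h
  · refine ⟨_, hz, ?_⟩
    rw [abs_of_nonpos (by linarith)] at h2
    linarith
  · rw [abs_of_nonneg (by linarith)] at h2
    rcases le_total (2 * p - pa) D with h' | h'
    · exact ⟨_, hz, by linarith⟩
    · exact ⟨_, hz', by linarith⟩

lemma exists_rel_near_tgt {e : M.E} {z xb : X} {p pb : ℝ} {y' : Y}
    (hp : p ∈ Icc 0 (M.len e)) (hz : C.rel z (M.param e p)) (hz' : C.rel z y')
    (hsum : M.len e - p + dist (M.tgt e) y' ≤ D) (hpb : pb ∈ Icc 0 (M.len e))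
    (hpbD : M.len e - pb ≤ D) (hxb : C.rel xb (M.param e pb)) :
    ∃ y, C.rel z y ∧ dist (M.tgt e) y + dist z xb ≤ 2 * D := by
  have hrev : ∀ s, M.reverse.param e (M.len e - s) = M.param e s := fun s => by
    show M.param e (M.len e - (M.len e - s)) = _
    rw [sub_sub_cancel]
  have hl : M.reverse.len e = M.len e := rfl
  have := exists_rel_near_src (C := C) (M := M.reverse) (e := e) (z := z) (xa := xb)
    (p := M.len e - p) (pa := M.len e - pb) (y' := y')
    ⟨by linarith [hp.2], by linarith [hp.1]⟩ (by rwa [hrev]) hz' (by rwa [M.reverse_src])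
    ⟨by linarith [hpb.2], by linarith [hpb.1]⟩ hpbD (by rwa [hrev])
  rwa [M.reverse_src] at this

/-- An edge crossed within a thin band of levels has close endpoints. -/
lemma dist_src_tgt_le_of_cross [CompactSpace X] [CompactSpace Y] (hX : IsGeodesicSpace X)
    {r : X} {yr : Y} (hr : C.rel r yr) {e : M.E} (hyr : yr ∉ M.openEdge e) {Q : Set X}
    (hQ : IsPreconnected Q) (hover : ∀ w ∈ Q, C.Over (M.edge e) w)
    (ha : ∃ w ∈ Q, C.Touch (M.src e) w) (hb : ∃ w ∈ Q, C.Touch (M.tgt e) w)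
    {t α la lb : ℝ} (hlev : ∀ w ∈ Q, dist r w ≤ t + α) (hla : 0 ≤ α + la) (hlb : 0 ≤ α + lb)
    {xa xb : X} {pa pb : ℝ} (hpa : pa ∈ Icc 0 (M.len e)) (hpaD : pa ≤ D)
    (hxa : C.rel xa (M.param e pa)) (hxal : t - la ≤ dist r xa)
    (hpb : pb ∈ Icc 0 (M.len e)) (hpbD : M.len e - pb ≤ D)
    (hxb : C.rel xb (M.param e pb)) (hxbl : t - lb ≤ dist r xb) :
    dist (M.src e) (M.tgt e) ≤ 2 * α + la + lb + 5 * D := by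
  have hD : 0 ≤ D := hpa.1.trans hpaD
  have := nonneg_of_switch (C := C) hQ (φ := fun y => dist (M.src e) y)
    (A₁ := α + la + 2 * D) (A₂ := -dist (M.src e) (M.tgt e) + α + lb + 2 * D)
    (fun p q => by rw [dist_comm _ p, dist_comm _ q]; exact abs_dist_sub_le _ _ _) ?_ ?_ ?_
  · linarith
  · intro w hw
    obtain ⟨z, hzD, ⟨_, ⟨p, hp, rfl⟩, hzp⟩, y', hy', hzy'⟩ := exists_descent_over_both hX
      (M.isClosed_edge e) (M.isOpen_openEdge e).isClosed_compl (M.edge_union_compl_openEdge e)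
      (hover w hw) ⟨yr, hyr, hr⟩
    have h1 := hlev w hw
    have h2 := hzD.dist_eq
    have hd := dist_le_of_rel_self hzp hzy'
    rcases M.exit_le hp hy' with h | h
    · left
      obtain ⟨y, hy, hyd⟩ := exists_rel_near_src hp hzp hzy' (h.trans hd) hpa hpaD hxa
      refine ⟨z, y, hy, ?_⟩
      have := dist_triangle r z xa
      linarith
    · right
      obtain ⟨y, hy, hyd⟩ := exists_rel_near_tgt hp hzp hzy' (h.trans hd) hpb hpbD hxb
      refine ⟨z, y, hy, ?_⟩
      have := dist_triangle r z xb
      have := dist_triangle_right (M.src e) (M.tgt e) y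
      linarith
  · obtain ⟨w, hw, hwt⟩ := ha
    obtain ⟨y, hy, hd⟩ := hwt.exists_rel
    refine ⟨w, hw, w, y, hy, ?_⟩
    rw [dist_self, dist_comm]
    linarith
  · obtain ⟨w, hw, hwt⟩ := hb
    obtain ⟨y, hy, hd⟩ := hwt.exists_rel
    refine ⟨w, hw, w, y, hy, ?_⟩
    have := dist_triangle (M.src e) y (M.tgt e)
    rw [dist_self]
    linarith

end ClosedCorr

namespace ClosedCorr

variable {X Y : Type*} [MetricSpace X] [MetricSpace Y] {D : ℝ} {C : ClosedCorr X Y D}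
variable {M : MetricGraphStruct Y}

lemma nonneg_of_rel {x : X} {y : Y} (h : C.rel x y) : 0 ≤ D := by
  simpa using dist_le_of_rel_self h h

lemma touch_of_rel_self {x : X} {y : Y} (h : C.rel x y) : C.Touch y x :=
  touch_of_rel h (by rw [dist_self]; linarith [nonneg_of_rel h])

section Cross

variable [CompactSpace X] [CompactSpace Y] (hX : IsGeodesicSpace X) {r : X} {yr : Y}
  (hr : C.rel r yr) {e : M.E} (hyr : yr ∈ M.vertexSet) {Q : Set X} (hQ : IsPreconnected Q)
  (hover : ∀ w ∈ Q, C.Over (M.edge e) w)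
  (ha : ∃ w ∈ Q, C.Touch (M.src e) w) (hb : ∃ w ∈ Q, C.Touch (M.tgt e) w)
  {t α : ℝ} (hα : 0 ≤ α) (hlev : ∀ w ∈ Q, |dist r w - t| ≤ α)

include hX hr hyr hQ hover ha hb hα hlev

lemma dist_src_tgt_le_band : dist (M.src e) (M.tgt e) ≤ 4 * α + 5 * D := by
  have hD := nonneg_of_rel hr
  obtain ⟨xa, hxa, hta⟩ := ha
  obtain ⟨xb, hxb, htb⟩ := hb
  have hla := abs_le.1 (hlev xa hxa)
  have hlb := abs_le.1 (hlev xb hxb)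
  rcases anchor_src (hover xa hxa) hta with ⟨pa, hpa, hpaD, hra⟩ | h
  · rcases anchor_tgt (hover xb hxb) htb with ⟨pb, hpb, hpbD, hrb⟩ | h
    · have := dist_src_tgt_le_of_cross hX hr (M.notMem_openEdge_of_mem_vertexSet hyr e) hQ hover
        ⟨xa, hxa, hta⟩ ⟨xb, hxb, htb⟩ (t := t) (α := α) (la := α) (lb := α)
        (fun w hw => by linarith [(abs_le.1 (hlev w hw)).2]) (by linarith) (by linarith)
        hpa hpaD hra (by linarith) hpb hpbD hrb (by linarith)
      linarith
    · linarith [dist_le_of_touch_self h htb]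
  · linarith [dist_le_of_touch_self hta h]

lemma dist_src_tgt_le_of_rel_src {x : X} (hx : C.rel x (M.src e)) (hxt : dist r x = t) :
    dist (M.src e) (M.tgt e) ≤ 3 * α + 5 * D := by
  have hD := nonneg_of_rel hr
  obtain ⟨xb, hxb, htb⟩ := hb
  have hlb := abs_le.1 (hlev xb hxb)
  rcases anchor_tgt (hover xb hxb) htb with ⟨pb, hpb, hpbD, hrb⟩ | h
  · have := dist_src_tgt_le_of_cross hX hr (M.notMem_openEdge_of_mem_vertexSet hyr e) hQ hover
      ha ⟨xb, hxb, htb⟩ (t := t) (α := α) (la := 0) (lb := α)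
      (fun w hw => by linarith [(abs_le.1 (hlev w hw)).2]) (by linarith) (by linarith)
      (M.zero_mem e) hD hx (by linarith) hpb hpbD hrb (by linarith)
    linarith
  · linarith [dist_le_of_touch_self h htb]

lemma dist_src_tgt_le_of_rel_tgt {x : X} (hx : C.rel x (M.tgt e)) (hxt : dist r x = t) :
    dist (M.src e) (M.tgt e) ≤ 3 * α + 5 * D := by
  have hD := nonneg_of_rel hr
  obtain ⟨xa, hxa, hta⟩ := ha
  have hla := abs_le.1 (hlev xa hxa)
  rcases anchor_src (hover xa hxa) hta with ⟨pa, hpa, hpaD, hra⟩ | h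
  · have := dist_src_tgt_le_of_cross hX hr (M.notMem_openEdge_of_mem_vertexSet hyr e) hQ hover
      ⟨xa, hxa, hta⟩ hb (t := t) (α := α) (la := α) (lb := 0)
      (fun w hw => by linarith [(abs_le.1 (hlev w hw)).2]) (by linarith) (by linarith)
      hpa hpaD hra (by linarith) (M.len_mem e) (by linarith) hx (by linarith)
    linarith
  · linarith [dist_le_of_touch_self hta h]

lemma dist_src_tgt_le_of_rel_both {x x' : X} (hx : C.rel x (M.src e)) (hxt : dist r x = t)
    (hx' : C.rel x' (M.tgt e)) (hxt' : dist r x' = t) :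
    dist (M.src e) (M.tgt e) ≤ 2 * α + 5 * D := by
  have hD := nonneg_of_rel hr
  have := dist_src_tgt_le_of_cross hX hr (M.notMem_openEdge_of_mem_vertexSet hyr e) hQ hover
    ha hb (t := t) (α := α) (la := 0) (lb := 0)
    (fun w hw => by linarith [(abs_le.1 (hlev w hw)).2]) (by linarith) (by linarith)
    (M.zero_mem e) hD hx (by linarith) (M.len_mem e) (by linarith) hx' (by linarith)
  linarith

omit ha hb hα hlev [CompactSpace X] hQ in
/-- Every point over an edge descends to a point touching an endpoint. -/
lemma exists_descent_touch_end {w : X} (hw : w ∈ Q) :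
    ∃ z, IsDescent r w z ∧ (C.Touch (M.src e) z ∨ C.Touch (M.tgt e) z) := by
  obtain ⟨z, hz, h1, y', hy', h2⟩ := exists_descent_over_both hX
    (M.isClosed_edge e) (M.isOpen_openEdge e).isClosed_compl (M.edge_union_compl_openEdge e)
    (hover w hw) ⟨yr, M.notMem_openEdge_of_mem_vertexSet hyr e, hr⟩
  exact ⟨z, hz, touch_end_of_rel h1 h2 hy'⟩

omit hα hlev in
lemma exists_two_descents : ∃ w ∈ Q, (∃ z, IsDescent r w z ∧ C.Touch (M.src e) z) ∧
    ∃ z, IsDescent r w z ∧ C.Touch (M.tgt e) z := by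
  have hD : IsClosed {q : X × X | IsDescent r q.1 q.2} :=
    isClosed_eq (f := fun q : X × X => dist r q.2 + dist q.2 q.1) (g := fun q => dist r q.1)
      (by fun_prop) (by fun_prop)
  refine hQ.exists_mem_both (hD.inter ((isClosed_touch (M.src e)).preimage continuous_snd))
    (hD.inter ((isClosed_touch (M.tgt e)).preimage continuous_snd)) ?_ ?_ ?_
  · intro w hw
    obtain ⟨z, hz, h⟩ := exists_descent_touch_end hX hr hyr hover hw
    exact h.imp (fun h => ⟨z, hz, h⟩) fun h => ⟨z, hz, h⟩
  · obtain ⟨w, hw, h⟩ := ha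
    exact ⟨w, hw, w, .refl r w, h⟩
  · obtain ⟨w, hw, h⟩ := hb
    exact ⟨w, hw, w, .refl r w, h⟩

/-- Two vertices all of whose incident edges are long are not joined by a crossed edge. -/
lemma src_eq_tgt_of_forall_lt_len {τ : ℝ} (hτ : 4 * α + 4 * D < τ)
    (h1 : ∀ e', M.src e' = M.src e ∨ M.tgt e' = M.src e → τ < M.len e')
    (h2 : ∀ e', M.src e' = M.tgt e ∨ M.tgt e' = M.tgt e → τ < M.len e') :
    M.src e = M.tgt e := by
  classical
  by_contra hne
  have hD := nonneg_of_rel hr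
  have hτ0 : 0 ≤ τ := by linarith
  obtain ⟨F1, F1'⟩ := M.le_dist_of_forall_lt_len hτ0 (M.src_mem_vertexSet e) h1
  obtain ⟨F2, F2'⟩ := M.le_dist_of_forall_lt_len hτ0 (M.tgt_mem_vertexSet e) h2
  have hd12 := F1' _ (M.tgt_mem_vertexSet e) (Ne.symm hne)
  set u₁ := M.src e with hu₁
  set u₂ := M.tgt e with hu₂
  let J : M.E → Prop := fun e' => (M.src e' = u₁ ∧ M.tgt e' = u₂) ∨ (M.src e' = u₂ ∧ M.tgt e' = u₁)
  have hJ : J e := .inl ⟨rfl, rfl⟩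
  let h : Y → ℝ := fun v => if v = u₁ then 0 else if v = u₂ then τ else τ / 2
  let ψ₁ : ℝ → ℝ := fun d => min (max (-d) (d - 2 * D)) (τ / 2)
  let ψ₂ : ℝ → ℝ := fun d => max (min (τ + d) (τ + 2 * D - d)) (τ / 2)
  have hψ₁ : ∀ a b, |ψ₁ a - ψ₁ b| ≤ |a - b| := by
    intro a b
    refine (abs_min_sub_min_le_max _ _ _ _).trans (max_le ?_ (by simp))
    refine (abs_max_sub_max_le_max _ _ _ _).trans (max_le ?_ (le_of_eq ?_))
    · rw [neg_sub_neg, abs_sub_comm]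
    · congr 1; ring
  have hψ₂ : ∀ a b, |ψ₂ a - ψ₂ b| ≤ |a - b| := by
    intro a b
    refine (abs_max_sub_max_le_max _ _ _ _).trans (max_le ?_ (by simp))
    refine (abs_min_sub_min_le_max _ _ _ _).trans (max_le (le_of_eq ?_) (le_of_eq ?_))
    · congr 1; ring
    · rw [abs_sub_comm]; congr 1; ring
  have hψ₁z : ∀ d, 0 ≤ d → d ≤ D → ψ₁ d = -d := by
    intro d h0 hd
    simp only [ψ₁]
    rw [max_eq_left (by linarith), min_eq_left (by linarith)]
  have hψ₂z : ∀ d, 0 ≤ d → d ≤ D → ψ₂ d = τ + d := by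
    intro d h0 hd
    simp only [ψ₂]
    rw [min_eq_left (by linarith), max_eq_left (by linarith)]
  have hψ₁f : ∀ d, τ ≤ d → ψ₁ d = τ / 2 := by
    intro d hd
    exact min_eq_right ((by linarith : τ / 2 ≤ d - 2 * D).trans (le_max_right _ _))
  have hψ₂f : ∀ d, τ ≤ d → ψ₂ d = τ / 2 := by
    intro d hd
    exact max_eq_right ((min_le_right _ _).trans (by linarith))
  let f : M.E → Y → ℝ := fun e' y =>
    if J e' then min (dist u₁ y) τ
    else if M.src e' = u₁ ∨ M.tgt e' = u₁ then ψ₁ (dist u₁ y)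
    else if M.src e' = u₂ ∨ M.tgt e' = u₂ then ψ₂ (dist u₂ y) else τ / 2
  have hend : ∀ e' v, (v = M.src e' ∨ v = M.tgt e') → f e' v = h v := by
    intro e' v hv
    have hvV : v ∈ M.vertexSet := ⟨e', hv⟩
    simp only [f, h]
    by_cases hv1 : v = u₁
    · have c2 : M.src e' = u₁ ∨ M.tgt e' = u₁ :=
        hv.imp (fun h => h.symm.trans hv1) fun h => h.symm.trans hv1
      rw [if_pos hv1, hv1, dist_self, hψ₁z 0 le_rfl hD, min_eq_left hτ0]
      by_cases hJ' : J e'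
      · rw [if_pos hJ']
      · rw [if_neg hJ', if_pos c2, neg_zero]
    · rw [if_neg hv1]
      have d1 := F1' v hvV hv1
      by_cases hv2 : v = u₂
      · rw [if_pos hv2]
        by_cases hJ' : J e'
        · rw [if_pos hJ', min_eq_right d1]
        · have c1 : ¬ (M.src e' = u₁ ∨ M.tgt e' = u₁) := by
            intro hc
            apply hJ'
            rcases hv with h | h <;> rcases hc with h' | h'
            · exact absurd (h.trans h') hv1
            · exact .inr ⟨h.symm.trans hv2, h'⟩
            · exact .inl ⟨h', h.symm.trans hv2⟩
            · exact absurd (h.trans h') hv1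
          have c2 : M.src e' = u₂ ∨ M.tgt e' = u₂ :=
            hv.imp (fun h => h.symm.trans hv2) fun h => h.symm.trans hv2
          rw [if_neg hJ', if_neg c1, if_pos c2, hv2, dist_self, hψ₂z 0 le_rfl hD, add_zero]
      · have d2 := F2' v hvV hv2
        have hJ' : ¬ J e' := by
          rintro (⟨a, b⟩ | ⟨a, b⟩) <;> rcases hv with h | h
          exacts [hv1 (h.trans a), hv2 (h.trans b), hv2 (h.trans a), hv1 (h.trans b)]
        rw [if_neg hv2, if_neg hJ', hψ₁f _ d1, hψ₂f _ d2]
        simp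
  have hf : ∀ e' y y', |f e' y - f e' y'| ≤ dist y y' := by
    intro e' y y'
    have t1 : ∀ u, |dist u y - dist u y'| ≤ dist y y' := fun u => by
      rw [dist_comm u, dist_comm u]; exact abs_dist_sub_le _ _ _
    simp only [f]
    split_ifs
    · exact (abs_min_sub_min_le_max _ _ _ _).trans (max_le (t1 _) (by simp))
    · exact (hψ₁ _ _).trans (t1 _)
    · exact (hψ₂ _ _).trans (t1 _)
    · simp
  obtain ⟨φ, hφ, hφv, hφL⟩ := M.exists_glue h (fun e' s => f e' (M.param e' s))
    (fun e' => hend e' _ (.inl rfl)) (fun e' => hend e' _ (.inr rfl))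
    (fun e' s hs t ht => (hf _ _ _).trans (M.dist_param_le e' hs ht))
  have hφ1 : φ u₁ = 0 := by rw [hφv _ (M.src_mem_vertexSet e)]; exact if_pos rfl
  have hφ2 : φ u₂ = τ := by 
    rw [hφv _ (M.tgt_mem_vertexSet e)]; exact (if_neg (Ne.symm hne)).trans (if_pos rfl)
  have val1 : ∀ y, (∀ e', J e' → y ∉ M.openEdge e') → dist u₁ y ≤ D → φ y = -dist u₁ y := by
    intro y hy hyD
    obtain ⟨e', s, hs, rfl⟩ := M.exists_mem_edge y
    by_cases hJ' : J e'
    · have hmem : M.param e' s ∈ M.edge e' := ⟨s, hs, rfl⟩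
      have hvV : M.param e' s ∈ M.vertexSet := by
        rcases M.mem_edge_cases hmem with h | h | h
        exacts [⟨e', .inl h⟩, ⟨e', .inr h⟩, absurd h (hy e' hJ')]
      by_cases hv1 : M.param e' s = u₁
      · rw [hv1, hφ1, dist_self, neg_zero]
      · linarith [F1' _ hvV hv1]
    · rw [hφ e' s hs]
      by_cases hc : M.src e' = u₁ ∨ M.tgt e' = u₁
      · simp only [f]
        rw [if_neg hJ', if_pos hc, hψ₁z _ dist_nonneg hyD]
      · have := F1 e' (fun h => hc (.inl h)) (fun h => hc (.inr h)) _ ⟨s, hs, rfl⟩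
        linarith
  have val2 : ∀ y, (∀ e', J e' → y ∉ M.openEdge e') → dist u₂ y ≤ D →
      φ y = τ + dist u₂ y := by
    intro y hy hyD
    obtain ⟨e', s, hs, rfl⟩ := M.exists_mem_edge y
    by_cases hJ' : J e'
    · have hmem : M.param e' s ∈ M.edge e' := ⟨s, hs, rfl⟩
      have hvV : M.param e' s ∈ M.vertexSet := by
        rcases M.mem_edge_cases hmem with h | h | h
        exacts [⟨e', .inl h⟩, ⟨e', .inr h⟩, absurd h (hy e' hJ')]
      by_cases hv1 : M.param e' s = u₂
      · rw [hv1, hφ2, dist_self, add_zero]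
      · linarith [F2' _ hvV hv1]
    · rw [hφ e' s hs]
      by_cases hc : M.src e' = u₂ ∨ M.tgt e' = u₂
      · have hc1 : ¬ (M.src e' = u₁ ∨ M.tgt e' = u₁) := by
          intro hc1
          rcases hc with h | h <;> rcases hc1 with h' | h'
          · exact hne (h'.symm.trans h)
          · exact hJ' (.inr ⟨h, h'⟩)
          · exact hJ' (.inl ⟨h', h⟩)
          · exact hne (h'.symm.trans h)
        simp only [f]
        rw [if_neg hJ', if_neg hc1, if_pos hc, hψ₂z _ dist_nonneg hyD]
      · have := F2 e' (fun h => hc (.inl h)) (fun h => hc (.inr h)) _ ⟨s, hs, rfl⟩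
        linarith
  obtain ⟨xa, hxa, hta⟩ := ha
  obtain ⟨xb, hxb, htb⟩ := hb
  have hla := abs_le.1 (hlev xa hxa)
  have hlb := abs_le.1 (hlev xb hxb)
  have := M.fintypeE
  have clA : IsClosed (⋃ e' ∈ {e' | J e'}, M.edge e') :=
    (Set.toFinite _).isClosed_biUnion fun e' _ => M.isClosed_edge e'
  have clB : IsClosed (⋃ e' ∈ {e' | J e'}, M.openEdge e')ᶜ :=
    (isOpen_biUnion fun e' _ => M.isOpen_openEdge e').isClosed_compl
  have clU : (⋃ e' ∈ {e' | J e'}, M.edge e') ∪ (⋃ e' ∈ {e' | J e'}, M.openEdge e')ᶜ = univ := by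
    refine eq_univ_of_forall fun y => ?_
    by_cases hy : y ∈ ⋃ e' ∈ {e' | J e'}, M.openEdge e'
    · exact .inl (biUnion_mono subset_rfl (fun e' _ => M.openEdge_subset_edge e') hy)
    · exact .inr hy
  have := nonneg_of_switch (C := C) hQ hφL (A₁ := 2 * α + 3 / 2 * D)
    (A₂ := 2 * α + 3 / 2 * D - τ) ?_ ?_ ?_
  · linarith
  · intro w hw
    obtain ⟨y₀, hy₀, hwy₀⟩ := hover w hw
    obtain ⟨z, hz, ⟨y, hy, hzy⟩, ⟨y', hy', hzy'⟩⟩ := exists_descent_over_both hX clA clB clU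
      ⟨y₀, mem_biUnion (show e ∈ {e' | J e'} from hJ) hy₀, hwy₀⟩
      ⟨yr, by
        intro hmem
        obtain ⟨e', -, he'⟩ := mem_iUnion₂.1 hmem
        exact M.notMem_openEdge_of_mem_vertexSet hyr e' he', hr⟩
    have hy'' : ∀ e', J e' → y' ∉ M.openEdge e' := fun e' he' hmem =>
      hy' (mem_biUnion (show e' ∈ {e' | J e'} from he') hmem)
    obtain ⟨e₁, hJ₁, p, hp, rfl⟩ := mem_iUnion₂.1 hy
    have hd := dist_le_of_rel_self hzy hzy'
    have hlw := abs_le.1 (hlev w hw)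
    have hzd := hz.dist_eq
    have near : dist u₁ y' ≤ D ∨ dist u₂ y' ≤ D := by
      rcases M.exit_le hp (hy'' e₁ hJ₁) with h | h <;> rcases hJ₁ with ⟨h3, h4⟩ | ⟨h3, h4⟩
      · left; rw [← h3]; linarith [hp.1]
      · right; rw [← h3]; linarith [hp.1]
      · right; rw [← h4]; linarith [hp.2]
      · left; rw [← h4]; linarith [hp.2]
    rcases near with h | h
    · left
      refine ⟨z, y', hzy', ?_⟩
      rw [val1 y' hy'' h]
      have t1 := dist_le_of_rel_touch hzy' hta
      rw [dist_comm y'] at t1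
      have := dist_triangle r z xa
      linarith
    · right
      refine ⟨z, y', hzy', ?_⟩
      rw [val2 y' hy'' h]
      have t1 := dist_le_of_rel_touch hzy' htb
      rw [dist_comm y'] at t1
      have := dist_triangle r z xb
      linarith
  · obtain ⟨y, hy, hd⟩ := hta.exists_rel
    refine ⟨xa, hxa, xa, y, hy, ?_⟩
    have := (abs_le.1 (hφL y u₁)).2
    rw [dist_self]
    linarith
  · obtain ⟨y, hy, hd⟩ := htb.exists_rel
    refine ⟨xb, hxb, xb, y, hy, ?_⟩
    have := (abs_le.1 (hφL y u₂)).1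
    rw [dist_self]
    linarith

end Cross

end ClosedCorr

/-- The intersection graph of a family of sets. -/
def hubGraph {X S : Type*} (H : S → Set X) : SimpleGraph S :=
  SimpleGraph.fromRel fun s s' => (H s ∩ H s').Nonempty

lemma hubGraph_reachable_of_mem {X S : Type*} {H : S → Set X} {s s' : S} {z : X}
    (h : z ∈ H s) (h' : z ∈ H s') : (hubGraph H).Reachable s s' := by
  rcases eq_or_ne s s' with rfl | hne
  · exact .refl s
  · exact ((SimpleGraph.fromRel_adj _ _ _).2 ⟨hne, .inl ⟨z, h, h'⟩⟩ : (hubGraph H).Adj s s').reachable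

lemma dist_le_of_hubGraph_walk {X S : Type*} [MetricSpace X] {H : S → Set X} {w : ℝ}
    (hw : ∀ s, ∀ z ∈ H s, ∀ z' ∈ H s, dist z z' ≤ w) {s s' : S} (p : (hubGraph H).Walk s s')
    {z z' : X} (hz : z ∈ H s) (hz' : z' ∈ H s') : dist z z' ≤ (p.length + 1) * w := by
  induction p generalizing z with
  | nil => simpa using hw _ z hz z' hz'
  | @cons s s₁ s' h p ih =>
    obtain ⟨q, hq, hq'⟩ : (H s ∩ H s₁).Nonempty := by
      rcases ((SimpleGraph.fromRel_adj _ _ _).1 h).2 with h | h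
      · exact h
      · rwa [inter_comm]
    have h1 := hw _ z hz q hq
    have h2 := ih hq' hz'
    have h3 := dist_triangle z q z'
    rw [SimpleGraph.Walk.length_cons]
    push_cast
    linarith

/-- Points of mutually reachable members of a finite family of sets of diameter at most `w`
are at distance at most `w` times the size of the family. -/
lemma dist_le_of_hubGraph_reachable {X S : Type*} [MetricSpace X] [Finite S] {H : S → Set X}
    {w : ℝ} (hw : ∀ s, ∀ z ∈ H s, ∀ z' ∈ H s, dist z z' ≤ w) {s s' : S}
    (h : (hubGraph H).Reachable s s') {z z' : X} (hz : z ∈ H s) (hz' : z' ∈ H s') :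
    dist z z' ≤ Nat.card S * w := by
  classical
  have := Fintype.ofFinite S
  obtain ⟨p, hp⟩ := h.exists_isPath
  have hw0 : 0 ≤ w := by simpa using hw _ z hz z hz
  have hl : (p.length : ℝ) + 1 ≤ Nat.card S := by
    rw [Nat.card_eq_fintype_card]
    exact_mod_cast hp.length_lt
  exact (dist_le_of_hubGraph_walk hw p hz hz').trans (by gcongr)

namespace MetricGraphStruct

variable {G : Type*} [MetricSpace G] (M : MetricGraphStruct G)

/-- The edges of length at most `τ` with an endpoint whose distance to `y` is within `ρ`
of `t`. -/
def shortNear (τ : ℝ) (y : G) (t ρ : ℝ) : Set M.E :=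
  {e | M.len e ≤ τ ∧ (|dist y (M.src e) - t| ≤ ρ ∨ |dist y (M.tgt e) - t| ≤ ρ)}

end MetricGraphStruct

namespace ClosedCorr

variable {X Y : Type*} [MetricSpace X] [MetricSpace Y] {D : ℝ} {C : ClosedCorr X Y D}
variable {M : MetricGraphStruct Y}

variable (C M) in
/-- The vertices of the graph touched by a point of `T`. -/
def touched (T : Set X) : Set Y := {v | v ∈ M.vertexSet ∧ ∃ w ∈ T, C.Touch v w}

section Level

variable [CompactSpace X] [CompactSpace Y] (hX : IsGeodesicSpace X) {r : X} {yr : Y}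
  (hr : C.rel r yr) (hyr : yr ∈ M.vertexSet) {c : ℝ → X} (hc : Continuous c)
  {t α : ℝ} (hα : 0 ≤ α) (hlev : ∀ w ∈ c '' Icc 0 1, |dist r w - t| ≤ α)

omit [CompactSpace X] in
include hc in
lemma crossing_cases (A : Set Y) {a b : Y} (ha : a ∈ touched C M (c '' Icc 0 1)) (haA : a ∈ A)
    (hb : b ∈ touched C M (c '' Icc 0 1)) (hbA : b ∉ A) :
    (∃ w ∈ c '' Icc 0 1, ∃ a ∈ M.vertexSet, ∃ b ∈ M.vertexSet, a ∈ A ∧ b ∉ A ∧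
      C.Touch a w ∧ C.Touch b w) ∨
    ∃ e, ∃ Q ⊆ c '' Icc 0 1, IsPreconnected Q ∧ (∀ w ∈ Q, C.Over (M.edge e) w) ∧
      (∃ w ∈ Q, C.Touch (M.src e) w) ∧ (∃ w ∈ Q, C.Touch (M.tgt e) w) ∧
      (M.src e ∈ A ∧ M.tgt e ∉ A ∨ M.src e ∉ A ∧ M.tgt e ∈ A) := by
  obtain ⟨haV, -, ⟨s, hs, rfl⟩, has⟩ := ha
  obtain ⟨hbV, -, ⟨s', hs', rfl⟩, hbs⟩ := hb
  rcases exists_crossing M hc A ⟨s, hs, a, haV, haA, has⟩ ⟨s', hs', b, hbV, hbA, hbs⟩ with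
    ⟨s, hs, h⟩ | h
  exacts [.inl ⟨c s, ⟨s, hs, rfl⟩, h⟩, .inr h]

omit [CompactSpace X] [CompactSpace Y] in
include hr hlev in
lemma abs_dist_sub_le_of_touched {v : Y} (hv : v ∈ touched C M (c '' Icc 0 1)) :
    |dist yr v - t| ≤ α + 3 / 2 * D := by
  obtain ⟨-, w, hw, h⟩ := hv
  have h1 := dist_le_of_rel_touch hr h
  have h2 := dist_le_of_rel_touch' hr h
  have h3 := abs_le.1 (hlev w hw)
  exact abs_le.2 ⟨by linarith, by linarith⟩

include hX hr hyr hc hα hlev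

/-- If a single vertex is touched by the path, then it is close to all points over the
central level. -/
lemma dist_le_of_touched_eq {v : Y} (hv : v ∈ touched C M (c '' Icc 0 1))
    (huniq : ∀ u ∈ touched C M (c '' Icc 0 1), u = v) {x : X} (hx : x ∈ c '' Icc 0 1)
    (hxt : dist r x = t) {y : Y} (hxy : C.rel x y) : dist y v ≤ 3 * α + 5 * D := by
  have hD := nonneg_of_rel hr
  by_cases hy : y ∈ M.vertexSet
  · rw [huniq y ⟨hy, x, hx, touch_of_rel_self hxy⟩, dist_self]
    positivity
  obtain ⟨M₁, hM₁, -⟩ := M.exists_subdivision hy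
  have hyr₁ : yr ∈ M₁.vertexSet := hM₁ ▸ mem_insert_of_mem _ hyr
  have key : ∀ u ∈ M₁.vertexSet, u ≠ y → ∀ w ∈ c '' Icc 0 1, C.Touch u w → u = v := by
    intro u hu huy w hw h
    rw [hM₁] at hu
    exact huniq u ⟨hu.resolve_left huy, w, hw, h⟩
  rcases crossing_cases (M := M₁) hc {y}
    ⟨hM₁ ▸ mem_insert _ _, x, hx, touch_of_rel_self hxy⟩ rfl
    (b := v) ⟨hM₁ ▸ mem_insert_of_mem _ hv.1, hv.2⟩ (fun h => hy (by
      rw [mem_singleton_iff] at h; exact h ▸ hv.1)) with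
    ⟨w, hw, a, -, b, hb, rfl, hby, haw, hbw⟩ | ⟨e, Q, hQc, hQ, hover, ha, hb, h | h⟩
  · rw [← key b hb hby w hw hbw]
    linarith [dist_le_of_touch_self haw hbw]
  · have hlevQ := fun w hw => hlev w (hQc hw)
    have h1 : M₁.src e = y := h.1
    obtain ⟨w, hw, hbw⟩ := hb
    have h2 := key _ (M₁.tgt_mem_vertexSet e) h.2 w (hQc hw) hbw
    have := dist_src_tgt_le_of_rel_src hX hr hyr₁ hQ hover ha ⟨w, hw, hbw⟩ hα hlevQ
      (h1.symm ▸ hxy) hxt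
    rwa [h1, h2] at this
  · have hlevQ := fun w hw => hlev w (hQc hw)
    have h1 : M₁.tgt e = y := h.2
    obtain ⟨w, hw, haw⟩ := ha
    have h2 := key _ (M₁.src_mem_vertexSet e) h.1 w (hQc hw) haw
    have := dist_src_tgt_le_of_rel_tgt hX hr hyr₁ hQ hover ⟨w, hw, haw⟩ hb hα hlevQ
      (h1.symm ▸ hxy) hxt
    rwa [h1, h2, dist_comm] at this

/-- If no vertex is touched by the path, then points over the central level are close. -/
lemma dist_le_of_touched_eq_empty (hemp : touched C M (c '' Icc 0 1) = ∅) {x x' : X}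
    (hx : x ∈ c '' Icc 0 1) (hxt : dist r x = t) (hx' : x' ∈ c '' Icc 0 1)
    (hxt' : dist r x' = t) {y y' : Y} (hxy : C.rel x y) (hxy' : C.rel x' y') :
    dist y y' ≤ 2 * α + 5 * D := by
  have hD := nonneg_of_rel hr
  have hV : ∀ v ∈ M.vertexSet, ∀ w ∈ c '' Icc 0 1, ¬ C.Touch v w := fun v hv w hw h =>
    hemp.subset (⟨hv, w, hw, h⟩ : v ∈ touched C M (c '' Icc 0 1))
  have hy : y ∉ M.vertexSet := fun h => hV y h x hx (touch_of_rel_self hxy)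
  have hy' : y' ∉ M.vertexSet := fun h => hV y' h x' hx' (touch_of_rel_self hxy')
  rcases eq_or_ne y' y with rfl | hne
  · rw [dist_self]; positivity
  obtain ⟨M₁, hM₁, -⟩ := M.exists_subdivision hy
  obtain ⟨M₂, hM₂, -⟩ := M₁.exists_subdivision (y := y') (by
    rw [hM₁]; rintro (h | h); exacts [hne h, hy' h])
  have hyr₂ : yr ∈ M₂.vertexSet := by
    rw [hM₂, hM₁]; exact mem_insert_of_mem _ (mem_insert_of_mem _ hyr)
  have key : ∀ u ∈ M₂.vertexSet, u ≠ y → ∀ w ∈ c '' Icc 0 1, C.Touch u w → u = y' := by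
    intro u hu huy w hw h
    rw [hM₂, hM₁] at hu
    rcases hu with hu | hu | hu
    exacts [hu, absurd hu huy, absurd h (hV u hu w hw)]
  rcases crossing_cases (M := M₂) hc {y} (a := y) (b := y')
    ⟨by rw [hM₂, hM₁]; exact mem_insert_of_mem _ (mem_insert _ _), x, hx,
      touch_of_rel_self hxy⟩ rfl
    ⟨by rw [hM₂]; exact mem_insert _ _, x', hx', touch_of_rel_self hxy'⟩ hne with
    ⟨w, hw, a, -, b, hb, rfl, hby, haw, hbw⟩ | ⟨e, Q, hQc, hQ, hover, ha, hb, h | h⟩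
  · rw [← key b hb hby w hw hbw]
    linarith [dist_le_of_touch_self haw hbw]
  · have hlevQ := fun w hw => hlev w (hQc hw)
    have h1 : M₂.src e = y := h.1
    obtain ⟨w, hw, hbw⟩ := hb
    have h2 := key _ (M₂.tgt_mem_vertexSet e) h.2 w (hQc hw) hbw
    have := dist_src_tgt_le_of_rel_both hX hr hyr₂ hQ hover ha ⟨w, hw, hbw⟩ hα hlevQ
      (h1.symm ▸ hxy) hxt (h2.symm ▸ hxy') hxt'
    rwa [h1, h2] at this
  · have hlevQ := fun w hw => hlev w (hQc hw)
    have h1 : M₂.tgt e = y := h.2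
    obtain ⟨w, hw, haw⟩ := ha
    have h2 := key _ (M₂.src_mem_vertexSet e) h.1 w (hQc hw) haw
    have := dist_src_tgt_le_of_rel_both hX hr hyr₂ hQ hover ⟨w, hw, haw⟩ hb hα hlevQ
      (h2.symm ▸ hxy') hxt' (h1.symm ▸ hxy) hxt
    rwa [h1, h2, dist_comm] at this

/-- A point of the path at the central level is close to a point touching some touched
vertex. -/
lemma exists_touch_near (hne : (touched C M (c '' Icc 0 1)).Nonempty) {x : X}
    (hx : x ∈ c '' Icc 0 1) (hxt : dist r x = t) :
    ∃ u ∈ touched C M (c '' Icc 0 1), ∃ z, C.Touch u z ∧ dist x z ≤ 3 * α + 5 * D := by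
  have hD := nonneg_of_rel hr
  obtain ⟨y, hxy⟩ := C.total x
  by_cases hy : y ∈ M.vertexSet
  · exact ⟨y, ⟨hy, x, hx, touch_of_rel_self hxy⟩, x, touch_of_rel_self hxy, by
      rw [dist_self]; positivity⟩
  obtain ⟨M₁, hM₁, -⟩ := M.exists_subdivision hy
  have hyr₁ : yr ∈ M₁.vertexSet := hM₁ ▸ mem_insert_of_mem _ hyr
  obtain ⟨v, hv⟩ := hne
  have aux : ∀ {w za zb xb : X} {b : Y}, w ∈ c '' Icc 0 1 → IsDescent r w za → C.Touch y za →
      IsDescent r w zb → C.Touch b zb → xb ∈ c '' Icc 0 1 → C.Touch b xb →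
      dist x zb ≤ 3 * α + 5 * D := by
    intro w za zb xb b hw hza hya hzb hyb hxb hbx
    have h1 := dist_le_of_rel_touch hxy hya
    rw [dist_self] at h1
    have h2 := hza.dist_eq
    have h3 := hzb.dist_eq
    have h4 := dist_le_of_touch hyb hbx
    rw [dist_self] at h4
    have h5 := abs_le.1 (hlev w hw)
    have h6 := abs_le.1 (hlev xb hxb)
    have h7 := dist_triangle r za x
    have h8 := dist_triangle r zb xb
    have h9 := dist_triangle4 x za w zb
    rw [dist_comm za x] at h7
    rw [dist_comm za w] at h9
    linarith
  rcases crossing_cases (M := M₁) hc {y}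
    ⟨hM₁ ▸ mem_insert _ _, x, hx, touch_of_rel_self hxy⟩ rfl
    (b := v) ⟨hM₁ ▸ mem_insert_of_mem _ hv.1, hv.2⟩ (fun h => hy (by
      rw [mem_singleton_iff] at h; exact h ▸ hv.1)) with
    ⟨w, hw, a, -, b, hb, rfl, hby, haw, hbw⟩ | ⟨e, Q, hQc, hQ, hover, ha, hb, h | h⟩
  · rw [hM₁] at hb
    refine ⟨b, ⟨hb.resolve_left hby, w, hw, hbw⟩, w, hbw, ?_⟩
    have := dist_le_of_rel_touch hxy haw
    rw [dist_self] at this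
    linarith
  · obtain ⟨w, hw, ⟨za, hza, hta⟩, zb, hzb, htb⟩ :=
      exists_two_descents hX hr hyr₁ hQ hover ha hb
    obtain ⟨xb, hxb, hbx⟩ := hb
    have hV := M₁.tgt_mem_vertexSet e
    rw [hM₁] at hV
    exact ⟨_, ⟨hV.resolve_left h.2, xb, hQc hxb, hbx⟩, zb, htb,
      aux (hQc hw) hza ((h.1 : M₁.src e = y) ▸ hta) hzb htb (hQc hxb) hbx⟩
  · obtain ⟨w, hw, ⟨za, hza, hta⟩, zb, hzb, htb⟩ :=
      exists_two_descents hX hr hyr₁ hQ hover ha hb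
    obtain ⟨xa, hxa, hax⟩ := ha
    have hV := M₁.src_mem_vertexSet e
    rw [hM₁] at hV
    exact ⟨_, ⟨hV.resolve_left h.1, xa, hQc hxa, hax⟩, za, hta,
      aux (hQc hw) hzb ((h.2 : M₁.tgt e = y) ▸ htb) hza hta (hQc hxa) hax⟩

end Level

end ClosedCorr

namespace ClosedCorr

variable {X Y : Type*} [MetricSpace X] [MetricSpace Y] {D : ℝ} {C : ClosedCorr X Y D}
variable {M : MetricGraphStruct Y}

section Hub

variable (C M) in
/-- The points touching a vertex within `κ` of an endpoint of the edge `e`. -/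
def hub (κ : ℝ) (e : M.E) : Set X :=
  {z | ∃ u ∈ M.vertexSet, (dist u (M.src e) ≤ κ ∨ dist u (M.tgt e) ≤ κ) ∧ C.Touch u z}

lemma dist_le_of_mem_hub {κ : ℝ} {e : M.E} {z z' : X} (hz : z ∈ hub C M κ e)
    (hz' : z' ∈ hub C M κ e) : dist z z' ≤ 2 * κ + M.len e + 2 * D := by
  obtain ⟨u, -, hu, h⟩ := hz
  obtain ⟨u', -, hu', h'⟩ := hz'
  have h1 := dist_le_of_touch h h'
  have h2 := M.dist_src_tgt_le e
  have h3 := (M.len_pos e).le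
  have h4 := dist_triangle u (M.src e) u'
  have h5 := dist_triangle u (M.tgt e) u'
  have h6 := dist_triangle4 u (M.src e) (M.tgt e) u'
  have h7 := dist_triangle4 u (M.tgt e) (M.src e) u'
  rw [dist_comm (M.src e) u'] at h4
  rw [dist_comm (M.tgt e) u'] at h5 h6
  rw [dist_comm (M.src e) u', dist_comm (M.tgt e) (M.src e)] at h7
  rcases hu with hu | hu <;> rcases hu' with hu' | hu' <;> linarith

variable [CompactSpace X] [CompactSpace Y] (hX : IsGeodesicSpace X) {r : X} {yr : Y}
  (hr : C.rel r yr) (hyr : yr ∈ M.vertexSet) {c : ℝ → X} (hc : Continuous c)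
  {t α τ : ℝ} (hα : 0 ≤ α) (hlev : ∀ w ∈ c '' Icc 0 1, |dist r w - t| ≤ α)
  (hτ : 4 * α + 4 * D < τ)

include hX hr hyr hc hα hlev hτ

/-- If all vertices touched by the path have only long incident edges, then at most one
vertex is touched. -/
lemma touched_subsingleton
    (htriv : ∀ v ∈ touched C M (c '' Icc 0 1), ∀ e, M.src e = v ∨ M.tgt e = v → τ < M.len e) :
    (touched C M (c '' Icc 0 1)).Subsingleton := by
  intro u hu v hv
  by_contra hne
  have hD := nonneg_of_rel hr
  rcases crossing_cases hc {u} hu rfl hv (Ne.symm hne) with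
    ⟨w, hw, a, haV, b, hbV, rfl, hba, haw, hbw⟩ | ⟨e, Q, hQc, hQ, hover, ha, hb, h⟩
  · have := (M.le_dist_of_forall_lt_len (by linarith) hbV (htriv b ⟨hbV, w, hw, hbw⟩)).2 a haV
      (Ne.symm hba)
    linarith [dist_le_of_touch_self hbw haw]
  · have hlevQ := fun w hw => hlev w (hQc hw)
    have := src_eq_tgt_of_forall_lt_len hX hr hyr hQ hover ha hb hα hlevQ hτ
      (htriv _ ⟨M.src_mem_vertexSet e, ha.imp fun w hw => ⟨hQc hw.1, hw.2⟩⟩)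
      (htriv _ ⟨M.tgt_mem_vertexSet e, hb.imp fun w hw => ⟨hQc hw.1, hw.2⟩⟩)
    rw [this] at h
    exact h.elim (fun h => h.2 h.1) fun h => h.1 h.2

/-- If some touched vertex `v₀` has a short incident edge `e₀`, all touched vertices lie in
hubs of short edges reachable from the hub of `e₀`. -/
lemma exists_reachable_hub {v₀ : Y} (hv₀ : v₀ ∈ touched C M (c '' Icc 0 1))
    (e₀ : M.shortNear τ yr t (α + 3 / 2 * D)) (he₀ : M.src e₀ = v₀ ∨ M.tgt e₀ = v₀)
    {v : Y} (hv : v ∈ touched C M (c '' Icc 0 1)) :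
    ∃ e : M.shortNear τ yr t (α + 3 / 2 * D),
      (hubGraph fun e : M.shortNear τ yr t (α + 3 / 2 * D) =>
        hub C M (4 * α + 5 * D) e).Reachable e₀ e ∧
      (dist v (M.src e) ≤ 4 * α + 5 * D ∨ dist v (M.tgt e) ≤ 4 * α + 5 * D) := by
  have hD := nonneg_of_rel hr
  set κ := 4 * α + 5 * D with hκ
  have hκ0 : 0 ≤ κ := by positivity
  have hnt : ∀ u ∈ touched C M (c '' Icc 0 1),
      (¬ ∀ e, M.src e = u ∨ M.tgt e = u → τ < M.len e) →
      ∃ e : M.shortNear τ yr t (α + 3 / 2 * D), ∀ u', dist u' u ≤ κ → dist u' (M.src e) ≤ κ ∨ dist u' (M.tgt e) ≤ κ := by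
    intro u hu h
    push Not at h
    obtain ⟨e, he, hlen⟩ := h
    have hl := abs_dist_sub_le_of_touched hr hlev hu
    refine ⟨⟨e, hlen, ?_⟩, fun u' hu' => ?_⟩
    · rcases he with rfl | rfl
      exacts [.inl hl, .inr hl]
    · rcases he with rfl | rfl
      exacts [.inl hu', .inr hu']
  let A : Set Y := {v | ∃ e : M.shortNear τ yr t (α + 3 / 2 * D), 
    (hubGraph fun e : M.shortNear τ yr t (α + 3 / 2 * D) => hub C M κ e).Reachable e₀ e ∧
    (dist v (M.src e) ≤ κ ∨ dist v (M.tgt e) ≤ κ)}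
  change v ∈ A
  by_contra hvA
  have hv₀A : v₀ ∈ A := ⟨e₀, .refl _, by
    rcases he₀ with rfl | rfl
    · exact .inl (by rwa [dist_self])
    · exact .inr (by rwa [dist_self])⟩
  have hcross : ∀ {a b : Y} {wa wb : X}, a ∈ M.vertexSet → b ∈ M.vertexSet → a ∈ A → b ∉ A →
      wa ∈ c '' Icc 0 1 → wb ∈ c '' Icc 0 1 → C.Touch a wa → C.Touch b wb → dist a b ≤ κ →
      (∀ e, M.src e = a ∨ M.tgt e = a → τ < M.len e) ∧
        ∀ e, M.src e = b ∨ M.tgt e = b → τ < M.len e := by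
    intro a b wa wb haV hbV haA hbA hwa hwb hta htb hab
    obtain ⟨ea, hea, hda⟩ := id haA
    have link : ∀ e : M.shortNear τ yr t (α + 3 / 2 * D), (∀ u', u' = a ∨ u' = b → dist u' (M.src e) ≤ κ ∨
        dist u' (M.tgt e) ≤ κ) → b ∈ A := fun e he =>
      ⟨e, hea.trans (hubGraph_reachable_of_mem (z := wa) ⟨a, haV, hda, hta⟩
        ⟨a, haV, he a (.inl rfl), hta⟩), he b (.inr rfl)⟩
    constructor
    · by_contra h
      obtain ⟨e, he⟩ := hnt a ⟨haV, wa, hwa, hta⟩ h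
      refine hbA (link e ?_)
      rintro u' (rfl | rfl)
      exacts [he _ (by rwa [dist_self]), he _ (by rwa [dist_comm])]
    · by_contra h
      obtain ⟨e, he⟩ := hnt b ⟨hbV, wb, hwb, htb⟩ h
      refine hbA (link e ?_)
      rintro u' (rfl | rfl)
      exacts [he _ hab, he _ (by rwa [dist_self])]
  rcases crossing_cases hc A hv₀ hv₀A hv hvA with
    ⟨w, hw, a, haV, b, hbV, haA, hbA, haw, hbw⟩ | ⟨e, Q, hQc, hQ, hover, ha, hb, h⟩
  · have hab := dist_le_of_touch_self haw hbw
    obtain ⟨-, h⟩ := hcross haV hbV haA hbA hw hw haw hbw (by linarith)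
    have := (M.le_dist_of_forall_lt_len (by linarith) hbV h).2 a haV (fun h => hbA (h ▸ haA))
    rw [dist_comm] at this
    linarith
  · have hlevQ := fun w hw => hlev w (hQc hw)
    have hband := dist_src_tgt_le_band hX hr hyr hQ hover ha hb hα hlevQ
    obtain ⟨wa, hwa, hta⟩ := id ha
    obtain ⟨wb, hwb, htb⟩ := id hb
    have hsV := M.src_mem_vertexSet e
    have htV := M.tgt_mem_vertexSet e
    have hlong : (∀ e', M.src e' = M.src e ∨ M.tgt e' = M.src e → τ < M.len e') ∧
        ∀ e', M.src e' = M.tgt e ∨ M.tgt e' = M.tgt e → τ < M.len e' := by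
      rcases h with ⟨h1, h2⟩ | ⟨h1, h2⟩
      · exact hcross hsV htV h1 h2 (hQc hwa) (hQc hwb) hta htb hband
      · exact (hcross htV hsV h2 h1 (hQc hwb) (hQc hwa) htb hta (by rwa [dist_comm])).symm
    have := src_eq_tgt_of_forall_lt_len hX hr hyr hQ hover ha hb hα hlevQ hτ hlong.1 hlong.2
    rw [this] at h
    exact h.elim (fun h => h.2 h.1) fun h => h.1 h.2

/-- Points at the central level of a path in a band are close, or close up to a multiple of
the number of short edges near that level. -/
lemma dist_le_of_path {x x' : X} (hx : x ∈ c '' Icc 0 1) (hxt : dist r x = t)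
    (hx' : x' ∈ c '' Icc 0 1) (hxt' : dist r x' = t) :
    dist x x' ≤ 6 * α + 11 * D ∨
    1 ≤ (M.shortNear τ yr t (α + 3 / 2 * D)).ncard ∧
      dist x x' ≤ 6 * α + 10 * D +
        (M.shortNear τ yr t (α + 3 / 2 * D)).ncard * (8 * α + 12 * D + τ) := by
  have hD := nonneg_of_rel hr
  have := M.fintypeE
  by_cases htriv : ∀ v ∈ touched C M (c '' Icc 0 1), ∀ e,
      M.src e = v ∨ M.tgt e = v → τ < M.len e
  · left
    obtain ⟨y, hxy⟩ := C.total x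
    obtain ⟨y', hxy'⟩ := C.total x'
    have h1 := dist_le_of_rel hxy hxy'
    rcases (touched_subsingleton hX hr hyr hc hα hlev hτ htriv).eq_empty_or_singleton with
      h | ⟨v, h⟩
    · have := dist_le_of_touched_eq_empty hX hr hyr hc hα hlev h hx hxt hx' hxt' hxy hxy'
      linarith
    · have hv : v ∈ touched C M (c '' Icc 0 1) := h ▸ rfl
      have hu : ∀ u ∈ touched C M (c '' Icc 0 1), u = v := fun u hu => by rwa [h] at hu
      have h2 := dist_le_of_touched_eq hX hr hyr hc hα hlev hv hu hx hxt hxy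
      have h3 := dist_le_of_touched_eq hX hr hyr hc hα hlev hv hu hx' hxt' hxy'
      linarith [dist_triangle_right y y' v]
  · right
    push Not at htriv
    obtain ⟨v₀, hv₀, e₀, he₀, hlen⟩ := htriv
    set S := M.shortNear τ yr t (α + 3 / 2 * D) with hS
    have he₀S : e₀ ∈ S := by
      have hl := abs_dist_sub_le_of_touched hr hlev hv₀
      refine ⟨hlen, ?_⟩
      rcases he₀ with rfl | rfl
      exacts [.inl hl, .inr hl]
    refine ⟨Set.Nonempty.ncard_pos (Set.toFinite _) ⟨e₀, he₀S⟩, ?_⟩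
    obtain ⟨u, hu, z, huz, hxz⟩ := exists_touch_near hX hr hyr hc hα hlev ⟨v₀, hv₀⟩ hx hxt
    obtain ⟨u', hu', z', huz', hxz'⟩ := exists_touch_near hX hr hyr hc hα hlev ⟨v₀, hv₀⟩ hx' hxt'
    obtain ⟨e, he, hd⟩ := exists_reachable_hub hX hr hyr hc hα hlev hτ hv₀ ⟨e₀, he₀S⟩ he₀ hu
    obtain ⟨e', he', hd'⟩ := exists_reachable_hub hX hr hyr hc hα hlev hτ hv₀ ⟨e₀, he₀S⟩ he₀ hu'
    have key := dist_le_of_hubGraph_reachable (w := 8 * α + 12 * D + τ)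
      (fun s z hz z' hz' => by
        have := dist_le_of_mem_hub hz hz'
        have := s.2.1
        linarith)
      (he.symm.trans he') (z := z) (z' := z') ⟨u, hu.1, hd, huz⟩ ⟨u', hu'.1, hd', huz'⟩
    rw [Nat.card_coe_set_eq] at key
    have := dist_triangle4 x z z' x'
    rw [dist_comm z' x'] at this
    linarith

end Hub

end ClosedCorr

lemma alphaReebRel.joinedIn {X : Type*} [MetricSpace X] {r : X} {ι : Type*} {I : ι → Set ℝ}
    {α : ℝ} (hα : 0 ≤ α) (hI : ∀ i, ∃ a b : ℝ, I i = Ioo a b ∧ b - a ≤ α) {x y : X}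
    (h : alphaReebRel r I x y) : JoinedIn {z | |dist r z - dist r x| ≤ α} x y := by
  induction h with
  | rel x y h =>
    obtain ⟨-, i, hi⟩ := h
    obtain ⟨a, b, hab, hlen⟩ := hI i
    have hx := hi.source_mem
    refine hi.mono fun z hz => ?_
    have hx : dist r x ∈ Ioo a b := hab ▸ hx
    have hz : dist r z ∈ Ioo a b := hab ▸ hz
    rw [mem_Ioo] at hx hz
    change |dist r z - dist r x| ≤ α
    exact abs_le.2 ⟨by linarith, by linarith⟩
  | refl x => exact .refl (by simpa using hα)
  | symm x y h ih => rw [← alphaReebRel.dist_eq h]; exact ih.symm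
  | trans x y z h h' ih ih' => rw [← alphaReebRel.dist_eq h] at ih'; exact ih.trans ih'

namespace MetricGraphStruct

variable {G : Type*} [MetricSpace G] (M : MetricGraphStruct G)

/-- Short edges near a high level are not incident to `y`. -/
lemma shortNear_subset {τ : ℝ} {y : G} {t ρ : ℝ} (ht : τ + ρ < t) :
    M.shortNear τ y t ρ ⊆ {e | M.len e ≤ τ ∧ M.src e ≠ y ∧ M.tgt e ≠ y} := by
  rintro e ⟨hlen, h⟩
  have h0 := (M.len_pos e).le
  have h1 := M.dist_src_tgt_le e
  refine ⟨hlen, fun hy => ?_, fun hy => ?_⟩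
  · rw [hy] at h h1
    rw [dist_self] at h
    rcases h with h | h <;> linarith [(abs_le.1 h).1]
  · rw [hy, dist_comm] at h1
    rw [hy, dist_self] at h
    rcases h with h | h <;> linarith [(abs_le.1 h).1]

/-- Short edges near two well separated levels, away from `y`, are counted separately. -/
lemma ncard_shortNear_add_le {τ : ℝ} {y : G} {t t' ρ : ℝ} (ht : τ + ρ < t) (ht' : τ + ρ < t')
    (hsep : t' + 2 * ρ + τ < t) :
    (M.shortNear τ y t ρ).ncard + (M.shortNear τ y t' ρ).ncard ≤ M.shortEdges τ y := by
  have := M.fintypeE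
  rw [← ncard_union_eq ?_ (toFinite _) (toFinite _)]
  · exact (ncard_le_ncard (union_subset (M.shortNear_subset ht) (M.shortNear_subset ht')) (toFinite _)).trans_eq
      (Nat.card_coe_set_eq _).symm
  · refine Set.disjoint_left.2 fun e he he' => ?_
    obtain ⟨-, h⟩ := he
    obtain ⟨hlen, h'⟩ := he'
    have h0 := (M.len_pos e).le
    have h1 := M.dist_src_tgt_le e
    have h2 := dist_triangle y (M.src e) (M.tgt e)
    have h3 := dist_triangle y (M.tgt e) (M.src e)
    rw [dist_comm (M.tgt e)] at h3
    rcases h with h | h <;> rcases h' with h' | h' <;> rw [abs_le] at h h' <;> linarith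

end MetricGraphStruct

namespace AlphaReebGraphOf

variable {X : Type*} [MetricSpace X] [CompactSpace X] {r : X} {ι : Type*} {I : ι → Set ℝ}
  {G : Type*} [MetricSpace G] {Y : Type*} [MetricSpace Y] [CompactSpace Y] {D : ℝ}

/-- Points of a fiber of `π` are close, or close up to a multiple of the number of short
edges near their level. -/
lemma dist_le_of_map_eq_level (R : AlphaReebGraphOf X r I G) (hX : IsGeodesicSpace X) {α : ℝ}
    (hα : 0 ≤ α) (hI : ∀ i, ∃ a b : ℝ, I i = Ioo a b ∧ b - a ≤ α) (C : ClosedCorr X Y D)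
    (M : MetricGraphStruct Y) {yr : Y} (hr : C.rel r yr) (hyr : yr ∈ M.vertexSet) {τ : ℝ}
    (hτ : 4 * α + 4 * D < τ) {x x' : X} (h : R.π x = R.π x') :
    dist x x' ≤ 6 * α + 11 * D ∨
    1 ≤ (M.shortNear τ yr (dist r x) (α + 3 / 2 * D)).ncard ∧
      dist x x' ≤ 6 * α + 10 * D +
        (M.shortNear τ yr (dist r x) (α + 3 / 2 * D)).ncard * (8 * α + 12 * D + τ) := by
  obtain ⟨γ, hγ⟩ := alphaReebRel.joinedIn hα hI ((R.eq_iff x x').1 h)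
  refine ClosedCorr.dist_le_of_path hX hr hyr γ.continuous_extend hα ?_ hτ
    ⟨0, by simp, γ.extend_zero⟩ rfl ⟨1, by simp, γ.extend_one⟩ (R.dist_eq_of_map_eq h).symm
  rintro _ ⟨s, hs, rfl⟩
  rw [γ.extend_apply hs]
  exact hγ ⟨s, hs⟩

/-- The diameter of the fibers of `π`, in terms of the number of short edges of a graph in
correspondence with `X`. -/
lemma dist_le_of_map_eq (R : AlphaReebGraphOf X r I G) (hX : IsGeodesicSpace X) {α : ℝ}
    (hα : 0 < α) (hI : ∀ i, ∃ a b : ℝ, I i = Ioo a b ∧ b - a ≤ α)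
    (hc : ∀ x, ∃ i, dist r x ∈ I i) (C : ClosedCorr X Y D) (M : MetricGraphStruct Y) {yr : Y}
    (hr : C.rel r yr) (hyr : yr ∈ M.vertexSet) {D' : ℝ} (hD' : D < D') {N : ℕ}
    (hN : M.shortEdges (4 * α + 4 * D') yr ≤ N) {x x' : X} (h : R.π x = R.π x') :
    dist x x' ≤ (16 + 8 * N) * α + (17 + 8 * N) * D' - min α (D' - D) := by
  have hD := ClosedCorr.nonneg_of_rel hr
  have hη1 := min_le_left α (D' - D)
  have hη2 := min_le_right α (D' - D)
  have hD'0 : 0 ≤ D' := hD.trans hD'.le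
  have hN0 : (0 : ℝ) ≤ N := N.cast_nonneg
  have hNα : 0 ≤ N * α := by positivity
  have hND : (N : ℝ) * D ≤ N * D' := by gcongr
  have hND0 : 0 ≤ N * D := by positivity
  have hIo : ∀ i, IsOpen (I i) := fun i => by
    obtain ⟨a, b, h, -⟩ := hI i
    rw [h]
    exact isOpen_Ioo
  have hτ : 4 * α + 4 * D < 4 * α + 4 * D' := by linarith
  have hxx := R.dist_eq_of_map_eq h
  have hroot : ∀ {z z' : X}, R.π z = R.π z' → dist z z' ≤ 2 * dist r z := fun {z z'} hz => by
    have h1 := dist_triangle z r z'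
    rw [dist_comm z r] at h1
    have h2 := R.dist_eq_of_map_eq hz
    linarith
  by_cases hlow : dist r x ≤ 5 * α + 11 / 2 * D'
  · linarith [hroot h]
  push Not at hlow
  rcases R.dist_le_of_map_eq_level hX hα.le hI C M hr hyr hτ h with h1 | ⟨hn, h1⟩
  · linarith
  have := M.fintypeE
  have hN1 : (1 : ℝ) ≤ N := by
    have hsub : (M.shortNear (4 * α + 4 * D') yr (dist r x) (α + 3 / 2 * D)).ncard ≤
        M.shortEdges (4 * α + 4 * D') yr :=
      (ncard_le_ncard (M.shortNear_subset (by linarith)) (toFinite _)).trans_eq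
        (Nat.card_coe_set_eq _).symm
    exact_mod_cast hn.trans (hsub.trans hN)
  have hNα1 : α ≤ N * α := le_mul_of_one_le_left hα.le hN1
  have hND1 : D' ≤ N * D' := le_mul_of_one_le_left (by linarith) hN1
  by_cases htop : dist r x < 6 * α + 7 * D'
  · linarith [hroot h]
  push Not at htop
  have hs : dist r x - (6 * α + 7 * D') ∈ Icc 0 (dist r x) := ⟨by linarith, by linarith⟩
  obtain ⟨z, hz, hzl⟩ := hX.exists_descent r x hs
  obtain ⟨z', hz', hzl'⟩ := hX.exists_descent r x' (hxx ▸ hs)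
  have hπ : R.π z = R.π z' := R.map_descent_eq hX hIo hc h hz hz' (by rw [hzl, hzl', hxx])
  have hd : dist x x' ≤ 2 * (6 * α + 7 * D') + dist z z' := by
    have h2 := hz.dist_eq
    have h3 := hz'.dist_eq
    have h4 := dist_triangle4 x z z' x'
    rw [dist_comm z' x'] at h4
    linarith
  by_cases hzlow : dist r z ≤ 5 * α + 11 / 2 * D'
  · linarith [hroot hπ]
  push Not at hzlow
  rcases R.dist_le_of_map_eq_level hX hα.le hI C M hr hyr hτ hπ with h2 | ⟨-, h2⟩
  · linarith
  have hsum := M.ncard_shortNear_add_le (τ := 4 * α + 4 * D') (y := yr) (t := dist r x)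
    (t' := dist r z) (ρ := α + 3 / 2 * D) (by linarith) (by linarith) (by linarith)
  have hsum' : ((M.shortNear (4 * α + 4 * D') yr (dist r x) (α + 3 / 2 * D)).ncard : ℝ) +
      (M.shortNear (4 * α + 4 * D') yr (dist r z) (α + 3 / 2 * D)).ncard ≤ N := by
    exact_mod_cast hsum.trans hN
  have hmul := mul_le_mul_of_nonneg_right hsum'
    (by positivity : 0 ≤ 8 * α + 12 * D + (4 * α + 4 * D'))
  linarith

end AlphaReebGraphOf

/-- If a compact connected geodesic space `X` is at Gromov-Hausdorff distance `< ε` from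
some finite metric graph `G'`, then the `α`-Reeb graph `G_α` of `d = d_X(r,·)`,
associated to a finite covering of `[0, diam X]` by open intervals of length at most `α`,
satisfies `d_GH(X,G_α) < (β₁(G_α)+1)(4 (2+N_{E,G'}(4(α+2ε))) (α+2ε) + ε)`. In particular
if every edge of `G'` is longer than `4(α+2ε)` then
`d_GH(X,G_α) < (β₁(G_α)+1)(8α+17ε)`. -/
theorem ghDist_alphaReeb_of_close_to_graph {X : Type*} [MetricSpace X] [CompactSpace X]
    [Nonempty X] [ConnectedSpace X] (hX : IsGeodesicSpace X) (r : X) (α : ℝ) (hα : 0 < α)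
    {ι : Type*} [Fintype ι] (I : ι → Set ℝ)
    (hI_int : ∀ i, ∃ a b : ℝ, I i = Set.Ioo a b ∧ b - a ≤ α)
    (hI_cov : Set.Icc (0 : ℝ) (Metric.diam (Set.univ : Set X)) ⊆ ⋃ i, I i)
    {G : Type*} [MetricSpace G] [CompactSpace G] [Nonempty G]
    (R : AlphaReebGraphOf X r I G)
    {G' : Type*} [MetricSpace G'] [CompactSpace G'] [Nonempty G'] [ConnectedSpace G']
    (M' : MetricGraphStruct G') (ε : ℝ) (hε : 0 < ε)
    (hGH : GromovHausdorff.ghDist X G' < ε) :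
    GromovHausdorff.ghDist X G <
      ((R.graph.betti1 : ℝ) + 1) *
        (4 * (2 + (M'.NE (4 * (α + 2 * ε)) : ℝ)) * (α + 2 * ε) + ε) ∧
    ((∀ e : M'.E, 4 * (α + 2 * ε) < M'.len e) →
      GromovHausdorff.ghDist X G <
        ((R.graph.betti1 : ℝ) + 1) * (8 * α + 17 * ε)) := by
  have main : GromovHausdorff.ghDist X G <
      ((R.graph.betti1 : ℝ) + 1) *
        (4 * (2 + (M'.NE (4 * (α + 2 * ε)) : ℝ)) * (α + 2 * ε) + ε) := by
    set N := M'.NE (4 * (α + 2 * ε)) with hNdef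
    obtain ⟨C⟩ := exists_closedCorr X G'
    obtain ⟨yr, hr⟩ := C.total r
    have hτ : 4 * α + 4 * (2 * ε) = 4 * (α + 2 * ε) := by ring
    obtain ⟨M, hyr, hN⟩ : ∃ M : MetricGraphStruct G', yr ∈ M.vertexSet ∧
        M.shortEdges (4 * α + 4 * (2 * ε)) yr ≤ N := by
      rw [hτ]
      by_cases hy : yr ∈ M'.vertexSet
      · exact ⟨M', hy, M'.shortEdges_le_NE _ _⟩
      · obtain ⟨M, hM, hN⟩ := M'.exists_subdivision hy
        exact ⟨M, hM ▸ mem_insert _ _, hN _⟩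
    have hc : ∀ x, ∃ i, dist r x ∈ I i := fun x =>
      mem_iUnion.1 (hI_cov ⟨dist_nonneg,
        dist_le_diam_of_mem isCompact_univ.isBounded (mem_univ _) (mem_univ _)⟩)
    have hIo : ∀ i, IsOpen (I i) := fun i => by
      obtain ⟨a, b, h, -⟩ := hI_int i
      rw [h]
      exact isOpen_Ioo
    have hlt : 2 * GromovHausdorff.ghDist X G' < 2 * ε := by linarith
    have hle := R.ghDist_le hX hIo hc fun x x' h =>
      R.dist_le_of_map_eq hX hα hI_int hc C M hr hyr hlt hN h
    have hη : 0 < min α (2 * ε - 2 * GromovHausdorff.ghDist X G') :=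
      lt_min hα (sub_pos.2 hlt)
    have hB : 0 ≤ 4 * (2 + (N : ℝ)) * (α + 2 * ε) + ε := by positivity
    have hβ := le_mul_of_one_le_left hB
      (by linarith [(R.graph.betti1 : ℕ).cast_nonneg (α := ℝ)] : 1 ≤ (R.graph.betti1 : ℝ) + 1)
    linarith
  refine ⟨main, fun hlong => ?_⟩
  have h0 : M'.NE (4 * (α + 2 * ε)) = 0 := by
    have : IsEmpty {e : M'.E // M'.len e ≤ 4 * (α + 2 * ε)} :=
      ⟨fun e => (hlong e.1).not_ge e.2⟩
    exact Nat.card_of_isEmpty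
  rw [h0] at main
  convert main using 2
  push_cast
  ring
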